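/- arXiv:math/0411269 — 2 statements merged into one kernel-verified Lean document; each statement's English description precedes it below -/
import Mathlib

section
/- Let X be a quasi-Banach space. Then X coarsely embeds into a (real, infinite-dimensional) Hilbert space if and only if there exists a probability space (Ω, 𝔅, μ) such that X is linearly isomorphic to a subspace of L₀(μ). -/
open Filter Function

/-- A quasi-norm on a real vector space `X`: nonnegative, vanishing exactly at `0`,
absolutely homogeneous, and satisfying a `K`-relaxed triangle inequality for some `K ≥ 1`. -/
structure IsQuasiNorm {X : Type*} [AddCommGroup X] [Module ℝ X] (q : X → ℝ) : Prop where
  nonneg : ∀ x, 0 ≤ q x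
  eq_zero_iff : ∀ x, q x = 0 ↔ x = 0
  smul : ∀ (c : ℝ) (x : X), q (c • x) = |c| * q x
  exists_K : ∃ K : ℝ, 1 ≤ K ∧ ∀ x y, q (x + y) ≤ K * (q x + q y)

/-- Completeness of the metrizable linear topology induced by the quasi-norm,
stated sequentially: every Cauchy sequence converges. -/
def QuasiNormComplete {X : Type*} [AddCommGroup X] [Module ℝ X] (q : X → ℝ) : Prop :=
  ∀ u : ℕ → X, (∀ ε > 0, ∃ N, ∀ m ≥ N, ∀ n ≥ N, q (u m - u n) < ε) →
    ∃ x : X, Tendsto (fun n => q (u n - x)) atTop (nhds 0)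

/-- A coarse embedding of a space with distance `d` into a (pseudo)metric space. -/
def IsCoarseEmbedding {X : Type*} {H : Type*} [PseudoMetricSpace H]
    (d : X → X → ℝ) (f : X → H) : Prop :=
  ∃ φ₁ φ₂ : ℝ → ℝ, Monotone φ₁ ∧ Monotone φ₂ ∧ Tendsto φ₁ atTop atTop ∧
    ∀ x y, φ₁ (d x y) ≤ dist (f x) (f y) ∧ dist (f x) (f y) ≤ φ₂ (d x y)

/-- A bundled real, infinite-dimensional Hilbert space. -/
structure InfDimHilbertSpace where
  carrier : Type
  [grp : NormedAddCommGroup carrier]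
  [ips : InnerProductSpace ℝ carrier]
  [cpl : CompleteSpace carrier]
  infdim : ¬ FiniteDimensional ℝ carrier

attribute [instance] InfDimHilbertSpace.grp InfDimHilbertSpace.ips InfDimHilbertSpace.cpl

/-- `X` (with quasi-norm `q`) coarsely embeds into a real infinite-dimensional Hilbert space. -/
def CoarselyEmbedsIntoHilbert (X : Type*) [AddCommGroup X] [Module ℝ X] (q : X → ℝ) : Prop :=
  ∃ (H : InfDimHilbertSpace) (f : X → H.carrier),
    IsCoarseEmbedding (fun x y => q (x - y)) f

/-- `X` is linearly isomorphic to a subspace of `L₀(μ)` for some probability space: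
there is an injective linear map `U` into the measurable functions such that a sequence
tends to `0` in `X` iff its image tends to `0` in measure. -/
def LinIsoSubspaceL0 (X : Type*) [AddCommGroup X] [Module ℝ X] (q : X → ℝ) : Prop :=
  ∃ (Ω : Type) (_ : MeasurableSpace Ω) (μ : MeasureTheory.Measure Ω), MeasureTheory.IsProbabilityMeasure μ ∧
    ∃ U : X →ₗ[ℝ] (Ω → ℝ), (∀ x, Measurable (U x)) ∧ Function.Injective U ∧
      ∀ u : ℕ → X,
        Tendsto (fun n => q (u n)) atTop (nhds 0) ↔
          MeasureTheory.TendstoInMeasure μ (fun n => U (u n)) atTop (0 : Ω → ℝ)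

open MeasureTheory Topology

namespace IsQuasiNorm

variable {X : Type*} [AddCommGroup X] [Module ℝ X] {q : X → ℝ}

lemma map_zero (hq : IsQuasiNorm q) : q 0 = 0 := (hq.eq_zero_iff 0).2 rfl

lemma map_neg (hq : IsQuasiNorm q) (x : X) : q (-x) = q x := by
  simpa using hq.smul (-1) x

lemma map_sub_rev (hq : IsQuasiNorm q) (x y : X) : q (x - y) = q (y - x) := by
  rw [← hq.map_neg, neg_sub]

/-- Aoki–Rolewicz in metric form: some power of a quasi-norm is equivalent to a pseudometric. -/
lemma exists_pseudoMetricSpace (hq : IsQuasiNorm q) :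
    ∃ p : ℝ, 0 < p ∧ ∃ _ : PseudoMetricSpace X,
      ∀ x y : X, dist x y ≤ q (x - y) ^ p ∧ q (x - y) ^ p ≤ 2 * dist x y := by
  obtain ⟨K, hK, hadd⟩ := hq.exists_K
  have hC : 1 < 3 * K ^ 2 := by nlinarith
  have hlog : 0 < Real.log (3 * K ^ 2) := Real.log_pos hC
  set p : ℝ := Real.log 2 / Real.log (3 * K ^ 2) with hp
  have hp0 : 0 < p := div_pos (Real.log_pos one_lt_two) hlog
  have hCp : (3 * K ^ 2) ^ p = 2 := by
    rw [Real.rpow_def_of_pos (by linarith), hp, mul_div_cancel₀ _ hlog.ne',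
      Real.exp_log two_pos]
  refine ⟨p, hp0, ?_⟩
  let d : X → X → NNReal := fun x y => ⟨q (x - y) ^ p, Real.rpow_nonneg (hq.nonneg _) _⟩
  have hd0 : ∀ x, d x x = 0 := fun x => by
    apply NNReal.eq
    change q (x - x) ^ p = 0
    rw [sub_self, hq.map_zero, Real.zero_rpow hp0.ne']
  have hdc : ∀ x y, d x y = d y x := fun x y => by
    apply NNReal.eq
    change q (x - y) ^ p = q (y - x) ^ p
    rw [hq.map_sub_rev]
  refine ⟨PseudoMetricSpace.ofPreNNDist d hd0 hdc, fun x y =>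
    ⟨PseudoMetricSpace.dist_ofPreNNDist_le d hd0 hdc x y,
      PseudoMetricSpace.le_two_mul_dist_ofPreNNDist d hd0 hdc (fun x₁ x₂ x₃ x₄ => ?_) x y⟩⟩
  rw [← NNReal.coe_le_coe]
  push_cast
  change q (x₁ - x₄) ^ p ≤ 2 * max (q (x₁ - x₂) ^ p) (max (q (x₂ - x₃) ^ p) (q (x₃ - x₄) ^ p))
  have hmono : ∀ a b : ℝ, 0 ≤ a → 0 ≤ b → max (a ^ p) (b ^ p) = max a b ^ p := by
    intro a b ha hb
    rcases le_total a b with h | h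
    · rw [max_eq_right h, max_eq_right (Real.rpow_le_rpow ha h hp0.le)]
    · rw [max_eq_left h, max_eq_left (Real.rpow_le_rpow hb h hp0.le)]
  rw [hmono _ _ (hq.nonneg _) (hq.nonneg _), hmono _ _ (hq.nonneg _)
    (le_max_of_le_left (hq.nonneg _)), ← hCp, ← Real.mul_rpow (by positivity)
    (le_max_of_le_left (hq.nonneg _))]
  refine Real.rpow_le_rpow (hq.nonneg _) ?_ hp0.le
  set m := max (q (x₁ - x₂)) (max (q (x₂ - x₃)) (q (x₃ - x₄)))
  have h1 : q (x₁ - x₂) ≤ m := le_max_left _ _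
  have h2 : q (x₂ - x₃) ≤ m := (le_max_left _ _).trans (le_max_right _ _)
  have h3 : q (x₃ - x₄) ≤ m := (le_max_right _ _).trans (le_max_right _ _)
  have hm : 0 ≤ m := (hq.nonneg _).trans h1
  have e1 := hadd (x₁ - x₂) (x₂ - x₄)
  have e2 := hadd (x₂ - x₃) (x₃ - x₄)
  simp only [sub_add_sub_cancel] at e1 e2
  have e3 : q (x₂ - x₄) ≤ K * (2 * m) := e2.trans (by gcongr; linarith)
  calc q (x₁ - x₄) ≤ K * (m + K * (2 * m)) := e1.trans (by gcongr)
    _ ≤ 3 * K ^ 2 * m := by nlinarith [mul_nonneg (sub_nonneg.2 hK) (mul_nonneg (by linarith : 0 ≤ K) hm)]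

end IsQuasiNorm
section GaussianKernel

open Matrix
open scoped Matrix

variable {ι : Type*} {H : Type*} [NormedAddCommGroup H] [InnerProductSpace ℝ H]

/-- The entrywise exponential of a real positive semidefinite matrix is positive semidefinite. -/
lemma Matrix.PosSemidef.map_exp [Finite ι] {A : Matrix ι ι ℝ} (hA : A.PosSemidef) :
    (A.map Real.exp).PosSemidef := by
  have := Fintype.ofFinite ι
  have hpow : ∀ n : ℕ, (A.map (· ^ n)).PosSemidef := by
    intro n
    induction n with
    | zero =>
      have := posSemidef_vecMulVec_self_star (fun _ : ι => (1 : ℝ))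
      have h : A.map (· ^ 0) = vecMulVec (fun _ : ι => (1 : ℝ)) (star fun _ => 1) := by
        ext i j
        simp [vecMulVec_apply]
      rwa [h]
    | succ n ih =>
      have h : A.map (· ^ (n + 1)) = A.map (· ^ n) ⊙ A := by
        ext i j
        simp [pow_succ]
      rw [h]
      exact ih.hadamard hA
  refine .of_dotProduct_mulVec_nonneg ?_ fun x => ?_
  · ext i j
    simpa using congrArg Real.exp (hA.isHermitian.apply i j)
  · have hsum : ∀ i j, HasSum (fun n : ℕ => x i * ((n.factorial : ℝ)⁻¹ * A i j ^ n) * x j)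
        (x i * Real.exp (A i j) * x j) := by
      intro i j
      have := NormedSpace.exp_series_hasSum_exp' (𝕂 := ℝ) (A i j)
      rw [← Real.exp_eq_exp_ℝ] at this
      exact (this.mul_left (x i)).mul_right (x j)
    have htot := hasSum_sum (s := Finset.univ) fun i _ =>
      hasSum_sum (s := Finset.univ) fun j _ => hsum i j
    have : star x ⬝ᵥ (A.map Real.exp) *ᵥ x = ∑ i, ∑ j, x i * Real.exp (A i j) * x j := by
      simp [dotProduct, mulVec, Finset.mul_sum, mul_assoc]
    rw [this]
    refine htot.nonneg fun n => ?_
    have h := mul_nonneg (inv_nonneg.2 (n.factorial.cast_nonneg (α := ℝ)))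
      ((hpow n).dotProduct_mulVec_nonneg x)
    convert h using 1
    simp only [dotProduct, mulVec, Finset.mul_sum, star_trivial, map_apply]
    exact Finset.sum_congr rfl fun i _ => Finset.sum_congr rfl fun j _ => by ring

/-- A Gaussian kernel on a Hilbert space is realised by vectors, on finitely many points. -/
lemma exists_inner_eq_exp_neg_norm_sq [Finite ι] (w : ι → H) {t : ℝ} (ht : 0 ≤ t) :
    ∃ (m : ℕ) (h : ι → EuclideanSpace ℝ (Fin m)), ∀ i j,
      inner ℝ (h i) (h j) = Real.exp (-(t * ‖w i - w j‖ ^ 2)) := by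
  have hG : ((2 * t) • gram ℝ w).PosSemidef := (posSemidef_gram ℝ w).smul (by positivity)
  have hD := (posSemidef_vecMulVec_self_star (fun i : ι => Real.exp (-(t * ‖w i‖ ^ 2)))).hadamard
    hG.map_exp
  obtain ⟨m, B, hB⟩ := posSemidef_iff_eq_sum_vecMulVec.1 hD
  refine ⟨m, fun i => WithLp.toLp 2 (fun k => B k i), fun i j => ?_⟩
  have := congrFun (congrFun hB i) j
  simp only [hadamard_apply, vecMulVec_apply, map_apply, Matrix.smul_apply, gram_apply,
    star_trivial, smul_eq_mul, Matrix.sum_apply, ← Real.exp_add] at this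
  rw [norm_sub_sq_real]
  simp only [PiLp.inner_apply, RCLike.inner_apply, conj_trivial]
  simp_rw [mul_comm (B _ j)]
  rw [← this]
  congr 1
  ring

end GaussianKernel
section HolderExtension

variable {E : Type*} [NormedAddCommGroup E] [InnerProductSpace ℝ E]

lemma sum_mul_norm_sq_sub_sum_smul {ι : Type*} (s : Finset ι) (h : ι → E) (l : ι → ℝ)
    (hl : ∑ i ∈ s, l i = 1) :
    ∑ i ∈ s, l i * ‖(∑ j ∈ s, l j • h j) - h i‖ ^ 2 =
      (∑ i ∈ s, ∑ j ∈ s, l i * l j * ‖h i - h j‖ ^ 2) / 2 := by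
  set y := ∑ j ∈ s, l j • h j with hy
  have hyi : ∀ x : E, ∑ j ∈ s, l j * inner ℝ x (h j) = inner ℝ x y := fun x => by
    simp [hy, inner_sum, inner_smul_right]
  have hiy : ∑ i ∈ s, l i * inner ℝ (h i) y = inner ℝ y y := by
    rw [← hyi y]
    simp_rw [real_inner_comm]
  have h1 : ∑ i ∈ s, l i * ‖y - h i‖ ^ 2 = ∑ i ∈ s, l i * ‖h i‖ ^ 2 - inner ℝ y y := by
    have : ∀ i, l i * ‖y - h i‖ ^ 2 =
        l i * inner ℝ y y - 2 * (l i * inner ℝ y (h i)) + l i * ‖h i‖ ^ 2 := fun i => by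
      rw [norm_sub_sq_real, real_inner_self_eq_norm_sq]; ring
    simp_rw [this]
    rw [Finset.sum_add_distrib, Finset.sum_sub_distrib, ← Finset.sum_mul, ← Finset.mul_sum, hl,
      hyi]
    ring
  have h2 : ∑ i ∈ s, ∑ j ∈ s, l i * l j * ‖h i - h j‖ ^ 2 =
      2 * ∑ i ∈ s, l i * ‖h i‖ ^ 2 - 2 * inner ℝ y y := by
    have : ∀ i, ∑ j ∈ s, l i * l j * ‖h i - h j‖ ^ 2 =
        l i * ‖h i‖ ^ 2 - 2 * (l i * inner ℝ (h i) y) + l i * ∑ j ∈ s, l j * ‖h j‖ ^ 2 := by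
      intro i
      have : ∀ j, l i * l j * ‖h i - h j‖ ^ 2 = l i * ‖h i‖ ^ 2 * l j
          - 2 * l i * (l j * inner ℝ (h i) (h j)) + l i * (l j * ‖h j‖ ^ 2) := fun j => by
        rw [norm_sub_sq_real]; ring
      simp_rw [this]
      rw [Finset.sum_add_distrib, Finset.sum_sub_distrib, ← Finset.mul_sum, ← Finset.mul_sum,
        ← Finset.mul_sum, hl, hyi]
      ring
    simp_rw [this]
    rw [Finset.sum_add_distrib, Finset.sum_sub_distrib, ← Finset.sum_mul, ← Finset.mul_sum, hl,
      hiy]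
    ring
  rw [h1, h2]
  ring

/-- One-point extension: the Helly-type property behind Minty's extension theorem. -/
lemma exists_forall_norm_sub_sq_le {ι : Type*} [Finite ι] (h : ι → E) (r : ι → ℝ)
    (hr : ∀ i, 0 < r i) (hh : ∀ i j, i ≠ j → ‖h i - h j‖ ^ 2 ≤ r i + r j) :
    ∃ y : E, ∀ i, ‖y - h i‖ ^ 2 ≤ r i := by
  classical
  have := Fintype.ofFinite ι
  by_contra! hcon
  obtain ⟨i₀, -⟩ := hcon 0
  let A : Set (ι → ℝ) := Set.univ.pi fun _ => Set.Iio 0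
  let C : Set (ι → ℝ) := {w | ∃ y : E, ∀ i, ‖y - h i‖ ^ 2 - r i ≤ w i}
  have hA : Convex ℝ A := convex_pi fun _ _ => convex_Iio 0
  have hAo : IsOpen A := isOpen_set_pi Set.finite_univ fun _ _ => isOpen_Iio
  have hC : Convex ℝ C := by
    rintro w ⟨y, hy⟩ w' ⟨y', hy'⟩ a b ha hb hab
    refine ⟨a • y + b • y', fun i => ?_⟩
    have hc : ConvexOn ℝ Set.univ fun z : E => ‖z - h i‖ ^ 2 :=
      ((convexOn_univ_norm (E := E)).comp_affineMap
        (AffineMap.id ℝ E - AffineMap.const ℝ E (h i))).pow (fun _ _ => norm_nonneg _) 2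
    have := hc.2 (Set.mem_univ y) (Set.mem_univ y') ha hb hab
    simp only [smul_eq_mul] at this
    simp only [Pi.add_apply, Pi.smul_apply, smul_eq_mul]
    have e1 := mul_le_mul_of_nonneg_left (hy i) ha
    have e2 := mul_le_mul_of_nonneg_left (hy' i) hb
    have e3 : r i = a * r i + b * r i := by rw [← add_mul, hab, one_mul]
    linarith
  have hdisj : Disjoint A C := by
    refine Set.disjoint_left.2 ?_
    rintro w hw ⟨y, hy⟩
    obtain ⟨i, hi⟩ := hcon y
    have := hw i (Set.mem_univ i)
    have h2 := hy i
    simp only [Set.mem_Iio] at this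
    linarith
  obtain ⟨f, u, hfA, hfC⟩ := geometric_hahn_banach_open hA hAo hC hdisj
  set l : ι → ℝ := fun i => f (Pi.single i 1) with hl
  have hf : ∀ w, f w = ∑ i, l i * w i := fun w => by
    conv_lhs => rw [← Finset.univ_sum_single w]
    rw [map_sum]
    refine Finset.sum_congr rfl fun i _ => ?_
    have : (Pi.single i (w i) : ι → ℝ) = w i • Pi.single i 1 := by
      rw [← Pi.single_smul]; simp
    rw [this, map_smul, smul_eq_mul, mul_comm]
  have hu : 0 ≤ u := by
    have hcl : (0 : ι → ℝ) ∈ closure A := by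
      rw [closure_pi_set]
      simp only [closure_Iio]
      exact fun i _ => Set.mem_Iic.2 le_rfl
    have : closure A ⊆ {w | f w ≤ u} :=
      closure_minimal (fun w hw => (hfA w hw).le) (isClosed_le f.continuous continuous_const)
    simpa using this hcl
  have hlnn : ∀ i, 0 ≤ l i := by
    intro i
    by_contra! hneg
    have hw : ∀ s : ℝ, 0 ≤ s → u ≤ f (fun j => ‖0 - h j‖ ^ 2 - r j) + s * l i := by
      intro s hs
      have := hfC ((fun j => ‖0 - h j‖ ^ 2 - r j) + s • Pi.single i 1) ⟨0, fun j => by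
        have : 0 ≤ (Pi.single i (1 : ℝ) : ι → ℝ) j := by
          by_cases hj : j = i
          · subst hj; simp
          · simp [hj]
        simp only [Pi.add_apply, Pi.smul_apply, smul_eq_mul]
        nlinarith [mul_nonneg hs this]⟩
      rwa [map_add, map_smul, smul_eq_mul] at this
    set c := f (fun j => ‖0 - h j‖ ^ 2 - r j)
    have := hw ((|c| + 1) / (-l i)) (by have := abs_nonneg c; apply div_nonneg <;> linarith)
    have e : (|c| + 1) / (-l i) * l i = -(|c| + 1) := by
      rw [div_mul_eq_mul_div, div_eq_iff (by linarith)]; ring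
    rw [e] at this
    linarith [le_abs_self c]
  have hsum : 0 < ∑ i, l i := by
    have h1 : f (fun _ => -1) < u := hfA _ fun i _ => by simp
    rcases (Finset.sum_nonneg fun i _ => hlnn i).lt_or_eq with h0 | h0
    · exact h0
    have hz : ∀ i, l i = 0 := fun i =>
      (Finset.sum_eq_zero_iff_of_nonneg fun i _ => hlnn i).1 h0.symm i (Finset.mem_univ i)
    have h2 := hfC (fun j => ‖0 - h j‖ ^ 2 - r j) ⟨0, fun i => le_rfl⟩
    rw [hf] at h1 h2
    simp only [hz, zero_mul, Finset.sum_const_zero] at h1 h2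
    linarith
  set T := ∑ i, l i with hT
  set m : ι → ℝ := fun i => l i / T with hm
  have hm0 : ∀ i, 0 ≤ m i := fun i => div_nonneg (hlnn i) hsum.le
  have hm1 : ∑ i, m i = 1 := by
    rw [hm, ← Finset.sum_div, div_self hsum.ne']
  have hge : 0 ≤ ∑ i, m i * (‖(∑ j, m j • h j) - h i‖ ^ 2 - r i) := by
    have := hu.trans (hfC (fun i => ‖(∑ j, m j • h j) - h i‖ ^ 2 - r i) ⟨_, fun i => le_rfl⟩)
    rw [hf] at this
    have h3 := div_nonneg this hsum.le
    rw [Finset.sum_div] at h3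
    refine h3.trans_eq (Finset.sum_congr rfl fun i _ => ?_)
    simp only [hm]
    ring
  have hkey : ∑ i, ∑ j, m i * m j * ‖h i - h j‖ ^ 2 ≤
      ∑ i, ∑ j, (m i * m j * (r i + r j) - if i = j then 2 * m i * m i * r i else 0) := by
    refine Finset.sum_le_sum fun i _ => Finset.sum_le_sum fun j _ => ?_
    by_cases hij : i = j
    · subst hij
      simp only [sub_self, norm_zero, if_true]
      nlinarith
    · rw [if_neg hij, sub_zero]
      exact mul_le_mul_of_nonneg_left (hh i j hij) (mul_nonneg (hm0 i) (hm0 j))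
  have hrhs : ∑ i, ∑ j, (m i * m j * (r i + r j) - if i = j then 2 * m i * m i * r i else 0) =
      2 * ∑ i, m i * r i - 2 * ∑ i, m i * m i * r i := by
    simp only [Finset.sum_sub_distrib, Finset.sum_ite_eq, Finset.mem_univ, if_true, mul_add,
      Finset.sum_add_distrib]
    have e1 : ∑ i, ∑ j, m i * m j * r i = ∑ i, m i * r i := by
      refine Finset.sum_congr rfl fun i _ => ?_
      rw [← Finset.sum_mul, ← Finset.mul_sum, hm1, mul_one]
    have e2 : ∑ i, ∑ j, m i * m j * r j = ∑ i, m i * r i := by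
      rw [Finset.sum_comm]
      refine Finset.sum_congr rfl fun i _ => ?_
      rw [← Finset.sum_mul, ← Finset.sum_mul, hm1, one_mul]
    rw [e1, e2, Finset.mul_sum (f := fun i => m i * m i * r i)]
    simp only [← mul_assoc]
    ring
  have hstrict : 0 < ∑ i, m i * m i * r i := by
    rcases (Finset.sum_nonneg fun i _ =>
      mul_nonneg (mul_self_nonneg (m i)) (hr i).le).lt_or_eq with h | h
    · exact h
    have hz : ∀ i, m i = 0 := fun i => by
      have := (Finset.sum_eq_zero_iff_of_nonneg fun i _ =>
        mul_nonneg (mul_self_nonneg (m i)) (hr i).le).1 h.symm i (Finset.mem_univ i)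
      simpa [(hr i).ne'] using this
    simp [hz] at hm1
  simp only [mul_sub, Finset.sum_sub_distrib] at hge
  rw [sum_mul_norm_sq_sub_sum_smul _ _ _ hm1] at hge
  linarith

/-- Finite form of Minty's theorem: `1/2`-Hölder maps into an inner product space extend. -/
lemma exists_holder_extension {X : Type*} [PseudoMetricSpace X] [DecidableEq X]
    (hsep : ∀ x y : X, x ≠ y → 0 < dist x y) {c : ℝ} (hc : 0 < c) (Z F : Finset X) (h : X → E)
    (hZ : ∀ z ∈ Z, ∀ w ∈ Z, ‖h z - h w‖ ^ 2 ≤ c * dist z w) :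
    ∃ g : X → E, (∀ z ∈ Z, g z = h z) ∧
      ∀ x ∈ Z ∪ F, ∀ y ∈ Z ∪ F, ‖g x - g y‖ ^ 2 ≤ c * dist x y := by
  induction F using Finset.induction_on with
  | empty => exact ⟨h, fun _ _ => rfl, by simpa using hZ⟩
  | insert a F haF ih =>
    obtain ⟨g, hg, hgF⟩ := ih
    by_cases ha : a ∈ Z ∪ F
    · refine ⟨g, hg, ?_⟩
      have : Z ∪ insert a F = Z ∪ F := by
        rw [Finset.union_insert, Finset.insert_eq_of_mem ha]
      rwa [this]
    have hne : ∀ z ∈ Z ∪ F, a ≠ z := fun z hz h => ha (h ▸ hz)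
    obtain ⟨y, hy⟩ := exists_forall_norm_sub_sq_le (ι := ↥(Z ∪ F)) (fun z => g z)
      (fun z => c * dist a z) (fun z => mul_pos hc (hsep _ _ (hne z z.2))) fun z w _ => by
        refine (hgF z z.2 w w.2).trans ?_
        rw [← mul_add]
        exact mul_le_mul_of_nonneg_left (dist_triangle_left _ _ _) hc.le
    have hup : ∀ z ∈ Z ∪ F, Function.update g a y z = g z := fun z hz =>
      Function.update_of_ne (hne z hz).symm _ _
    refine ⟨Function.update g a y, fun z hz => ?_, ?_⟩
    · rw [hup z (Finset.mem_union_left _ hz), hg z hz]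
    · rw [Finset.union_insert]
      intro x hx x' hx'
      rcases Finset.mem_insert.1 hx with rfl | hxF <;> rcases Finset.mem_insert.1 hx' with rfl | hxF'
      · simp
      · rw [Function.update_self, hup x' hxF']
        exact hy ⟨x', hxF'⟩
      · rw [Function.update_self, hup x hxF, norm_sub_rev, dist_comm]
        exact hy ⟨x, hxF⟩
      · rw [hup x hxF, hup x' hxF']
        exact hgF x hxF x' hxF'

end HolderExtension
section InvariantKernel

variable {X : Type*} [AddCommGroup X] [Module ℝ X] {q : X → ℝ}

lemma Finset.exists_maximal_separated {X : Type*} [PseudoMetricSpace X] (F : Finset X) :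
    ∃ Z ⊆ F, (∀ z ∈ Z, ∀ w ∈ Z, z ≠ w → 1 ≤ dist z w) ∧ ∀ x ∈ F, ∃ z ∈ Z, dist x z < 1 := by
  classical
  let P := F.powerset.filter fun Z => ∀ z ∈ Z, ∀ w ∈ Z, z ≠ w → 1 ≤ dist z w
  have hP : P.Nonempty := ⟨∅, by simp [P]⟩
  obtain ⟨Z, hZP, hmax⟩ := P.exists_max_image Finset.card hP
  simp only [P, Finset.mem_filter, Finset.mem_powerset] at hZP hmax
  refine ⟨Z, hZP.1, hZP.2, fun x hx => ?_⟩
  by_contra! hcon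
  have hxZ : x ∉ Z := fun h => absurd (hcon x h) (by simp)
  have := hmax (insert x Z) ⟨Finset.insert_subset hx hZP.1, ?_⟩
  · rw [Finset.card_insert_of_notMem hxZ] at this
    omega
  · intro z hz w hw hzw
    rcases Finset.mem_insert.1 hz with h | h <;> rcases Finset.mem_insert.1 hw with h' | h'
    · exact absurd (h.trans h'.symm) hzw
    · rw [h]; exact hcon w h'
    · rw [h', dist_comm]; exact hcon z h
    · exact hZP.2 z h w h' hzw

/-- A coarse embedding into a Hilbert space yields, on every finite set, unit vectors whose
correlations are uniformly close to `1` at small distances and uniformly away from `1` at large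
distances. -/
lemma IsQuasiNorm.exists_unit_vectors (hq : IsQuasiNorm q) {H : Type*} [NormedAddCommGroup H]
    [InnerProductSpace ℝ H] {f : X → H} (hf : IsCoarseEmbedding (fun x y => q (x - y)) f) :
    ∃ p : ℝ, 0 < p ∧ ∃ δ : ℝ, 0 < δ ∧ ∃ R : ℝ, 0 < R ∧ ∀ F : Finset X,
      ∃ (m : ℕ) (v : X → EuclideanSpace ℝ (Fin m)), (∀ x ∈ F, ‖v x‖ = 1) ∧
        ∀ x ∈ F, ∀ y ∈ F, 1 - q (x - y) ^ p ≤ inner ℝ (v x) (v y) ∧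
          (R ≤ q (x - y) → inner ℝ (v x) (v y) ≤ 1 - δ) := by
  classical
  obtain ⟨p, hp, _, hd⟩ := hq.exists_pseudoMetricSpace
  obtain ⟨φ₁, φ₂, hφ₁, hφ₂, hφ₁t, hφ⟩ := hf
  have hq_le : ∀ {x y : X} {s : ℝ}, 0 ≤ s → q (x - y) ^ p ≤ s → q (x - y) ≤ s ^ p⁻¹ := by
    intro x y s hs h
    have := Real.rpow_le_rpow (Real.rpow_nonneg (hq.nonneg _) _) h (inv_nonneg.2 hp.le)
    rwa [Real.rpow_rpow_inv (hq.nonneg _) hp.ne'] at this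
  have hsep : ∀ x y : X, x ≠ y → 0 < dist x y := by
    intro x y hxy
    have : 0 < q (x - y) :=
      (hq.nonneg _).lt_of_ne fun h => hxy (sub_eq_zero.1 ((hq.eq_zero_iff _).1 h.symm))
    have := Real.rpow_pos_of_pos this p
    linarith [(hd x y).2]
  set L := φ₂ ((64 : ℝ) ^ p⁻¹) with hL
  set t : ℝ := 1 / (32 * (L ^ 2 + 1)) with ht
  have ht0 : 0 < t := by positivity
  obtain ⟨R₁, hR₁⟩ := Filter.eventually_atTop.1
    (hφ₁t.eventually_ge_atTop (Real.sqrt (1 / t)))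
  set R₂ := max R₁ 0 with hR₂
  let R := (2 * (R₂ ^ p + 2)) ^ p⁻¹
  have hR₂0 : 0 ≤ R₂ := le_max_right _ _
  have hR₂p : 0 ≤ R₂ ^ p := Real.rpow_nonneg hR₂0 _
  have hexp : Real.exp (-1) ≤ 1 / 2 := by
    have := Real.exp_one_gt_d9
    rw [Real.exp_neg, inv_eq_one_div]
    exact one_div_le_one_div_of_le two_pos (by linarith)
  have hexp4 : Real.exp (-(1 / 4)) < 1 := by
    rw [← Real.exp_zero]
    exact Real.exp_lt_exp.2 (by norm_num)
  refine ⟨p, hp, 1 - Real.exp (-(1 / 4)), by linarith, R, Real.rpow_pos_of_pos (by positivity) _,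
    fun F => ?_⟩
  obtain ⟨Z, hZF, hZsep, hZcov⟩ := F.exists_maximal_separated
  obtain ⟨m, h', hh'⟩ := exists_inner_eq_exp_neg_norm_sq (fun x : F => f x) ht0.le
  let h : X → EuclideanSpace ℝ (Fin m) := fun x => if hx : x ∈ F then h' ⟨x, hx⟩ else 0
  have hh : ∀ x ∈ F, ∀ y ∈ F, inner ℝ (h x) (h y) = Real.exp (-(t * ‖f x - f y‖ ^ 2)) := by
    intro x hx y hy
    simp only [h, hx, hy, dif_pos]
    exact hh' _ _
  have hhn : ∀ x ∈ F, ‖h x‖ ^ 2 = 1 := fun x hx => by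
    rw [← real_inner_self_eq_norm_sq, hh x hx x hx]; simp
  have hhd : ∀ x ∈ F, ∀ y ∈ F,
      ‖h x - h y‖ ^ 2 = 2 - 2 * Real.exp (-(t * ‖f x - f y‖ ^ 2)) := by
    intro x hx y hy
    rw [norm_sub_sq_real, hhn x hx, hhn y hy, hh x hx y hy]; ring
  have hhZ : ∀ z ∈ Z, ∀ w ∈ Z, ‖h z - h w‖ ^ 2 ≤ 1 / 16 * dist z w := by
    intro z hz w hw
    rcases eq_or_ne z w with rfl | hzw
    · simp
    rw [hhd z (hZF hz) w (hZF hw)]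
    have h1 := hZsep z hz w hw hzw
    rcases le_or_gt 32 (dist z w) with h32 | h32
    · linarith [Real.exp_pos (-(t * ‖f z - f w‖ ^ 2))]
    · have hq64 : q (z - w) ≤ (64 : ℝ) ^ p⁻¹ := hq_le (by norm_num) (by linarith [(hd z w).2])
      have hfL : ‖f z - f w‖ ≤ L := by
        rw [← dist_eq_norm]
        exact (hφ z w).2.trans (hφ₂ hq64)
      have hfL2 : ‖f z - f w‖ ^ 2 ≤ L ^ 2 := pow_le_pow_left₀ (norm_nonneg _) hfL 2
      have htL : t * ‖f z - f w‖ ^ 2 ≤ 1 / 32 := by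
        rw [ht, div_mul_eq_mul_div, div_le_div_iff₀ (by positivity) (by norm_num)]
        linarith
      linarith [Real.add_one_le_exp (-(t * ‖f z - f w‖ ^ 2))]
  obtain ⟨g, hgZ, hgF⟩ := exists_holder_extension hsep (by norm_num : (0 : ℝ) < 1 / 16) Z F h hhZ
  rw [Finset.union_eq_right.2 hZF] at hgF
  obtain ⟨m', v', hv'⟩ := exists_inner_eq_exp_neg_norm_sq (fun x : F => g x) zero_le_one
  let v : X → EuclideanSpace ℝ (Fin m') := fun x => if hx : x ∈ F then v' ⟨x, hx⟩ else 0
  have hv : ∀ x ∈ F, ∀ y ∈ F, inner ℝ (v x) (v y) = Real.exp (-‖g x - g y‖ ^ 2) := by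
    intro x hx y hy
    simp only [v, hx, hy, dif_pos]
    rw [hv', one_mul]
  refine ⟨m', v, fun x hx => ?_, fun x hx y hy => ?_⟩
  · have : ‖v x‖ ^ 2 = 1 := by
      rw [← real_inner_self_eq_norm_sq, hv x hx x hx]; simp
    exact (pow_eq_one_iff_of_nonneg (norm_nonneg _) two_ne_zero).1 this
  rw [hv x hx y hy]
  refine ⟨?_, fun hqR => ?_⟩
  · have h1 := Real.add_one_le_exp (-‖g x - g y‖ ^ 2)
    have h2 := hgF x hx y hy
    have h3 := (hd x y).1
    have h4 : (0 : ℝ) ≤ dist x y := dist_nonneg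
    linarith
  · obtain ⟨z, hz, hxz⟩ := hZcov x hx
    obtain ⟨w, hw, hyw⟩ := hZcov y hy
    have hqp : 2 * (R₂ ^ p + 2) ≤ q (x - y) ^ p := by
      have := Real.rpow_le_rpow (Real.rpow_nonneg (by positivity) _) hqR hp.le
      rwa [Real.rpow_inv_rpow (by positivity) hp.ne'] at this
    have hzw : R₂ ^ p ≤ q (z - w) ^ p := by
      have h1 := dist_triangle4_right x y z w
      have h2 := (hd x y).2
      have h3 := (hd z w).1
      linarith
    have hzwR : R₁ ≤ q (z - w) :=
      (le_max_left _ _).trans ((Real.rpow_le_rpow_iff hR₂0 (hq.nonneg _) hp).1 hzw)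
    have hfzw : Real.sqrt (1 / t) ≤ ‖f z - f w‖ := by
      rw [← dist_eq_norm]
      exact (hR₁ _ hzwR).trans (hφ z w).1
    have htf : 1 ≤ t * ‖f z - f w‖ ^ 2 := by
      have := Real.sqrt_le_left (by positivity) |>.1 hfzw
      rwa [div_le_iff₀' ht0] at this
    have hhzw : 1 ≤ ‖h z - h w‖ := by
      rw [← one_le_sq_iff₀ (norm_nonneg _), hhd z (hZF hz) w (hZF hw)]
      have : Real.exp (-(t * ‖f z - f w‖ ^ 2)) ≤ Real.exp (-1) := Real.exp_le_exp.2 (by linarith)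
      linarith
    have hnear : ∀ a ∈ F, ∀ b ∈ F, dist a b < 1 → ‖g a - g b‖ ≤ 1 / 4 := by
      intro a ha b hb hab
      refine abs_le_of_sq_le_sq' ?_ (by norm_num) |>.2
      linarith [hgF a ha b hb]
    have hgx := hnear x hx z (hZF hz) hxz
    have hgy := hnear y hy w (hZF hw) hyw
    have hgxy : 1 / 2 ≤ ‖g x - g y‖ := by
      have e : h z - h w = (g x - g y) - (g x - g z) + (g y - g w) := by
        rw [hgZ z hz, hgZ w hw]; abel
      have := norm_add_le ((g x - g y) - (g x - g z)) (g y - g w)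
      rw [← e] at this
      linarith [norm_sub_le (g x - g y) (g x - g z)]
    have : Real.exp (-‖g x - g y‖ ^ 2) ≤ Real.exp (-(1 / 4)) := by
      refine Real.exp_le_exp.2 (neg_le_neg ?_)
      nlinarith
    linarith

end InvariantKernel
section Bochner

lemma Circle.re_mul_re_eq (z w : Circle) :
    (z : ℂ).re * (w : ℂ).re = (((z * w : Circle) : ℂ).re + ((z * w⁻¹ : Circle) : ℂ).re) / 2 := by
  rw [Circle.coe_mul, Circle.coe_mul, Circle.coe_inv_eq_conj, Complex.mul_re, Complex.mul_re,
    Complex.conj_re, Complex.conj_im]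
  ring

lemma Circle.re_mul_inv_eq (z w : Circle) :
    ((z * w⁻¹ : Circle) : ℂ).re = (z : ℂ).re * (w : ℂ).re + (z : ℂ).im * (w : ℂ).im := by
  rw [Circle.coe_mul, Circle.coe_inv_eq_conj, Complex.mul_re, Complex.conj_re, Complex.conj_im]
  ring

/-- A Fejér-type density: unit vectors indexed by a finite set of characters of a compact
probability space give a new probability measure with prescribed Fourier coefficients. -/
lemma exists_probabilityMeasure_integral_re {G : Type*} [AddCommGroup G] [DecidableEq G]
    {Ω : Type*} [TopologicalSpace Ω] [CompactSpace Ω] [MeasurableSpace Ω] [BorelSpace Ω]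
    (P : Measure Ω) [IsProbabilityMeasure P] (χ : Multiplicative G →* (Ω → Circle))
    (hc : ∀ m, Continuous (χ m))
    (hInt : ∀ m : G, m ≠ 0 → ∫ ω, (χ (.ofAdd m) ω : ℂ).re ∂P = 0)
    {E : Type*} [NormedAddCommGroup E] [InnerProductSpace ℝ E] (B : Finset G) (hB : B.Nonempty)
    (v : G → E) (hv : ∀ k ∈ B, ‖v k‖ = 1) :
    ∃ μ : ProbabilityMeasure Ω, ∀ m : G, ∫ ω, (χ (.ofAdd m) ω : ℂ).re ∂(μ : Measure Ω) =
      (∑ k ∈ B with k + m ∈ B, inner ℝ (v (k + m)) (v k)) / B.card := by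
  set ψ : G → Ω → ℝ := fun m ω => (χ (.ofAdd m) ω : ℂ).re with hψ
  have hψc : ∀ m, Continuous (ψ m) := fun m =>
    Complex.continuous_re.comp (continuous_subtype_val.comp (hc _))
  have hψi : ∀ m, ∫ ω, ψ m ω ∂P = if m = 0 then 1 else 0 := by
    intro m
    split_ifs with h
    · subst h; simp [hψ]
    · exact hInt m h
  have hInt' : ∀ {f : Ω → ℝ}, Continuous f → Integrable f P := fun hf =>
    hf.integrable_of_hasCompactSupport (HasCompactSupport.of_compactSpace _)
  have hsub : ∀ m n ω, χ (.ofAdd (m - n)) ω = χ (.ofAdd m) ω * (χ (.ofAdd n) ω)⁻¹ := by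
    intro m n ω
    rw [ofAdd_sub, map_div, Pi.div_apply, div_eq_mul_inv]
  have hmul : ∀ m n ω, ψ m ω * ψ n ω = (ψ (m + n) ω + ψ (m - n) ω) / 2 := by
    intro m n ω
    simp only [hψ, hsub, Circle.re_mul_re_eq, ofAdd_add, map_mul, Pi.mul_apply]
  have hcard : (0 : ℝ) < B.card := by exact_mod_cast hB.card_pos
  set g : Ω → ℝ := fun ω => (∑ k ∈ B, ∑ l ∈ B, inner ℝ (v k) (v l) * ψ (k - l) ω) / B.card with hg
  have hg0 : ∀ ω, 0 ≤ g ω := by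
    intro ω
    refine div_nonneg ?_ hcard.le
    have : ∑ k ∈ B, ∑ l ∈ B, inner ℝ (v k) (v l) * ψ (k - l) ω =
        ‖∑ k ∈ B, (χ (.ofAdd k) ω : ℂ).re • v k‖ ^ 2 +
          ‖∑ k ∈ B, (χ (.ofAdd k) ω : ℂ).im • v k‖ ^ 2 := by
      simp only [← real_inner_self_eq_norm_sq, sum_inner, inner_sum, real_inner_smul_left,
        real_inner_smul_right, ← Finset.sum_add_distrib]
      refine Finset.sum_congr rfl fun k _ => Finset.sum_congr rfl fun l _ => ?_
      simp only [hψ]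
      rw [hsub, Circle.re_mul_inv_eq, real_inner_comm]
      ring
    rw [this]
    positivity
  have hgc : Continuous g := by
    refine Continuous.div_const (continuous_finsetSum _ fun k _ =>
      continuous_finsetSum _ fun l _ => continuous_const.mul (hψc _)) _
  have hkey : ∀ m, ∫ ω, g ω * ψ m ω ∂P =
      (∑ k ∈ B with k + m ∈ B, inner ℝ (v (k + m)) (v k)) / B.card := by
    intro m
    have h1 : ∀ ω, g ω * ψ m ω = (∑ k ∈ B, ∑ l ∈ B,
        inner ℝ (v k) (v l) * ((ψ (k - l + m) ω + ψ (k - l - m) ω) / 2)) / B.card := by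
      intro ω
      rw [hg, div_mul_eq_mul_div, Finset.sum_mul]
      congr 1
      refine Finset.sum_congr rfl fun k _ => ?_
      rw [Finset.sum_mul]
      refine Finset.sum_congr rfl fun l _ => ?_
      rw [mul_assoc, hmul]
    simp_rw [h1]
    rw [integral_div, integral_finsetSum _ fun k _ => hInt' (by fun_prop)]
    congr 1
    have h2 : ∀ k l, ∫ ω, inner ℝ (v k) (v l) * ((ψ (k - l + m) ω + ψ (k - l - m) ω) / 2) ∂P =
        ((if l = k + m then inner ℝ (v k) (v l) else 0) +
          if k = l + m then inner ℝ (v k) (v l) else 0) / 2 := by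
      intro k l
      rw [integral_const_mul, integral_div, integral_add (hInt' (hψc _)) (hInt' (hψc _)), hψi, hψi]
      have e1 : k - l + m = 0 ↔ l = k + m := by
        rw [← sub_eq_zero (a := l), ← neg_eq_zero]; congr! 1; abel
      have e2 : k - l - m = 0 ↔ k = l + m := by
        rw [← sub_eq_zero (a := k)]; congr! 1; abel
      simp only [e1, e2]
      split_ifs <;> ring
    have h3 : ∀ k ∈ B, ∫ ω, ∑ l ∈ B,
        inner ℝ (v k) (v l) * ((ψ (k - l + m) ω + ψ (k - l - m) ω) / 2) ∂P =
        ∑ l ∈ B, ((if l = k + m then inner ℝ (v k) (v l) else 0) +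
          if k = l + m then inner ℝ (v k) (v l) else 0) / 2 := by
      intro k _
      rw [integral_finsetSum _ fun l _ => hInt' (by fun_prop)]
      exact Finset.sum_congr rfl fun l _ => h2 k l
    rw [Finset.sum_congr rfl h3]
    simp only [← Finset.sum_div, Finset.sum_add_distrib]
    rw [Finset.sum_comm (f := fun k l => if k = l + m then inner ℝ (v k) (v l) else 0)]
    simp only [Finset.sum_ite_eq', Finset.sum_filter]
    simp_rw [real_inner_comm]
    ring
  have hg1 : ∫ ω, g ω ∂P = 1 := by
    have := hkey 0
    have h0 : ∀ ω, ψ 0 ω = 1 := fun ω => by simp [hψ]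
    simp only [h0, mul_one, add_zero] at this
    rw [this, Finset.filter_true_of_mem fun k hk => hk]
    have : ∑ k ∈ B, inner ℝ (v k) (v k) = (B.card : ℝ) := by
      rw [Finset.sum_congr rfl fun k hk => by
        rw [real_inner_self_eq_norm_sq, hv k hk, one_pow]]
      simp
    rw [this, div_self hcard.ne']
  have hprob : IsProbabilityMeasure (P.withDensity fun ω => ENNReal.ofReal (g ω)) := by
    constructor
    rw [withDensity_apply _ MeasurableSet.univ, Measure.restrict_univ,
      ← ofReal_integral_eq_lintegral_ofReal (hInt' hgc) (Filter.Eventually.of_forall hg0), hg1,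
      ENNReal.ofReal_one]
  refine ⟨⟨_, hprob⟩, fun m => ?_⟩
  rw [← hkey m]
  change ∫ ω, ψ m ω ∂(P.withDensity fun ω => ENNReal.ofReal (g ω)) = _
  rw [integral_withDensity_eq_integral_toReal_smul hgc.measurable.ennreal_ofReal
    (Filter.Eventually.of_forall fun _ => ENNReal.ofReal_lt_top)]
  simp only [ENNReal.toReal_ofReal (hg0 _), smul_eq_mul]

/-- The compact group of all circle-valued functions, with its Borel `σ`-algebra. -/
def Torus (ι : Type*) : Type _ := ι → Circle

namespace Torus

variable {ι : Type*}

noncomputable instance : CommGroup (Torus ι) := inferInstanceAs (CommGroup (ι → Circle))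
noncomputable instance : TopologicalSpace (Torus ι) := inferInstanceAs (TopologicalSpace (ι → Circle))
instance : IsTopologicalGroup (Torus ι) := inferInstanceAs (IsTopologicalGroup (ι → Circle))
instance : CompactSpace (Torus ι) := inferInstanceAs (CompactSpace (ι → Circle))
instance : T2Space (Torus ι) := inferInstanceAs (T2Space (ι → Circle))
noncomputable instance : MeasurableSpace (Torus ι) := borel _
instance : BorelSpace (Torus ι) := ⟨rfl⟩

lemma continuous_eval (s : ι) : Continuous fun ω : Torus ι => ω s := continuous_apply (A := fun _ : ι => Circle) s

/-- The character of the torus with given integer frequencies. -/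
noncomputable def char (ι : Type*) : Multiplicative (ι →₀ ℤ) →* (Torus ι → Circle) where
  toFun m ω := m.toAdd.prod fun s n => ω s ^ n
  map_one' := by ext; simp
  map_mul' m n := by
    ext ω
    rw [toAdd_mul, Finsupp.prod_add_index' (fun _ => zpow_zero _) (fun _ _ _ => zpow_add _ _ _)]
    rfl

lemma char_apply (m : ι →₀ ℤ) (ω : Torus ι) :
    char ι (.ofAdd m) ω = m.prod fun s n => ω s ^ n := rfl

lemma continuous_char (m : Multiplicative (ι →₀ ℤ)) : Continuous (char ι m) :=
  continuous_finsetProd _ fun s _ => (continuous_eval s).zpow _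

lemma char_mul (m : Multiplicative (ι →₀ ℤ)) (a ω : Torus ι) :
    char ι m (a * ω) = char ι m a * char ι m ω := by
  change m.toAdd.prod _ = m.toAdd.prod _ * m.toAdd.prod _
  rw [← Finsupp.prod_mul]
  refine Finsupp.prod_congr fun s _ => ?_
  exact mul_zpow (a s) (ω s) _

lemma exists_char_ne_one {m : ι →₀ ℤ} (hm : m ≠ 0) : ∃ a : Torus ι, char ι (.ofAdd m) a ≠ 1 := by
  classical
  obtain ⟨s, hs⟩ := Finsupp.ne_iff.1 hm
  rw [Finsupp.coe_zero, Pi.zero_apply] at hs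
  let a : Torus ι := Pi.mulSingle (M := fun _ : ι => Circle) s (Circle.exp (Real.pi / m s))
  have has : a s = Circle.exp (Real.pi / m s) := Pi.mulSingle_eq_same (M := fun _ : ι => Circle) _ _
  have hab : ∀ b ≠ s, a b = 1 := fun b hb =>
    Pi.mulSingle_eq_of_ne (M := fun _ : ι => Circle) hb _
  refine ⟨a, ?_⟩
  rw [char_apply, Finsupp.prod, Finset.prod_eq_single s]
  · rw [has, ← Circle.exp_zsmul]
    intro h
    have h1 : (m s • (Real.pi / m s) : ℝ) = Real.pi := by
      rw [zsmul_eq_mul, mul_div_cancel₀]; exact_mod_cast hs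
    rw [h1] at h
    have := congrArg (fun z : Circle => (z : ℂ)) h
    simp [Circle.coe_exp] at this
    norm_num at this
  · intro b _ hb
    rw [hab b hb, one_zpow]
  · intro h
    rw [Finsupp.notMem_support_iff.1 h, zpow_zero]

/-- The normalized Haar measure of the torus. -/
noncomputable def haar (ι : Type*) : Measure (Torus ι) := Measure.haarMeasure ⊤

instance : IsProbabilityMeasure (haar ι) := ⟨Measure.haarMeasure_self (K₀ := ⊤)⟩

lemma integral_re_char {m : ι →₀ ℤ} (hm : m ≠ 0) :
    ∫ ω, (char ι (.ofAdd m) ω : ℂ).re ∂(haar ι) = 0 := by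
  obtain ⟨a, ha⟩ := exists_char_ne_one hm
  have hcont : Continuous fun ω => (char ι (.ofAdd m) ω : ℂ) :=
    continuous_subtype_val.comp (continuous_char _)
  have hInt : Integrable (fun ω => (char ι (.ofAdd m) ω : ℂ)) (haar ι) :=
    hcont.integrable_of_hasCompactSupport (HasCompactSupport.of_compactSpace _)
  have : (haar ι).IsMulLeftInvariant := Measure.isMulLeftInvariant_haarMeasure _
  have h := integral_mul_left_eq_self (μ := haar ι) (fun ω => (char ι (.ofAdd m) ω : ℂ)) a
  simp only [char_mul, Circle.coe_mul] at h
  rw [integral_const_mul] at h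
  have h0 : ∫ ω, (char ι (.ofAdd m) ω : ℂ) ∂(haar ι) = 0 := by
    by_contra hne
    exact ha (Circle.ext ((mul_eq_right₀ hne).1 h))
  have := integral_re (𝕜 := ℂ) hInt
  simp only [RCLike.re_to_complex] at this
  rw [this, h0, Complex.zero_re]

end Torus

end Bochner
section Folner

/-- The discrete box of finitely supported integer sequences. -/
noncomputable def finsuppBox {ι : Type*} (α : Finset ι × ℕ) : Finset (ι →₀ ℤ) :=
  α.1.finsupp fun _ => Finset.Ico 0 (α.2 : ℤ)

lemma tendsto_card_overlap_div (n : ℤ) :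
    Tendsto (fun M : ℕ => ((Finset.Ico (max 0 (-n)) (min (M : ℤ) (M - n))).card : ℝ) / M)
      atTop (𝓝 1) := by
  have h : Tendsto (fun M : ℕ => 1 - |(n : ℝ)| / M) atTop (𝓝 (1 - 0)) :=
    tendsto_const_nhds.sub (tendsto_const_div_atTop_nhds_zero_nat _)
  rw [sub_zero] at h
  refine h.congr' ?_
  filter_upwards [eventually_ge_atTop n.natAbs, eventually_gt_atTop 0] with M hM hM0
  have h1 : ((Finset.Ico (max 0 (-n)) (min (M : ℤ) (M - n))).card : ℤ) = M - |n| := by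
    rw [Int.card_Ico, Int.abs_eq_natAbs]
    omega
  have h2 : ((Finset.Ico (max 0 (-n)) (min (M : ℤ) (M - n))).card : ℝ) = M - |(n : ℝ)| := by
    exact_mod_cast h1
  have : (M : ℝ) ≠ 0 := by positivity
  rw [h2]
  field_simp

open Classical in
lemma tendsto_finsuppBox_overlap {ι : Type*} (m : ι →₀ ℤ) :
    Tendsto (fun α : Finset ι × ℕ =>
      ((finsuppBox α).filter (fun k => k + m ∈ finsuppBox α)).card / ((finsuppBox α).card : ℝ))
      atTop (𝓝 1) := by
  have hL : Tendsto (fun α : Finset ι × ℕ => ∏ s ∈ m.support,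
      ((Finset.Ico (max 0 (-m s)) (min (α.2 : ℤ) (α.2 - m s))).card : ℝ) / α.2) atTop (𝓝 1) := by
    have h := tendsto_finsetProd m.support fun s _ =>
      (tendsto_card_overlap_div (m s)).comp
        (tendsto_snd (f := (atTop : Filter (Finset ι))) (g := atTop))
    rw [prod_atTop_atTop_eq] at h
    simpa using h
  refine tendsto_of_tendsto_of_tendsto_of_le_of_le' hL tendsto_const_nhds ?_ ?_
  · filter_upwards [eventually_ge_atTop (m.support, 1)] with α hα
    obtain ⟨S, M⟩ := α
    obtain ⟨hS : m.support ⊆ S, hM : 1 ≤ M⟩ := hα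
    have hM0 : (M : ℝ) ≠ 0 := by positivity
    have hcard : ((finsuppBox (S, M)).card : ℝ) = ∏ _s ∈ S, (M : ℝ) := by
      simp [finsuppBox, Finset.card_finsupp]
    have hsub : S.finsupp (fun s => Finset.Ico (max 0 (-m s)) (min (M : ℤ) (M - m s))) ⊆
        (finsuppBox (S, M)).filter (fun k => k + m ∈ finsuppBox (S, M)) := by
      intro k hk
      rw [Finset.mem_finsupp_iff] at hk
      simp only [finsuppBox, Finset.mem_filter, Finset.mem_finsupp_iff]
      refine ⟨⟨hk.1, fun s hs => ?_⟩, Finsupp.support_add.trans (Finset.union_subset hk.1 hS),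
        fun s hs => ?_⟩
      all_goals
        have := hk.2 s hs
        simp only [Finset.mem_Ico, Finsupp.add_apply] at this ⊢
        omega
    have hle : ∏ s ∈ S, ((Finset.Ico (max 0 (-m s)) (min (M : ℤ) (M - m s))).card : ℝ) ≤
        ((finsuppBox (S, M)).filter (fun k => k + m ∈ finsuppBox (S, M))).card := by
      have := Finset.card_le_card hsub
      rw [Finset.card_finsupp] at this
      exact_mod_cast this
    have hprod : ∏ s ∈ m.support,
        ((Finset.Ico (max 0 (-m s)) (min (M : ℤ) (M - m s))).card : ℝ) / M =
        ∏ s ∈ S, ((Finset.Ico (max 0 (-m s)) (min (M : ℤ) (M - m s))).card : ℝ) / M := by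
      refine Finset.prod_subset hS fun s _ hs => ?_
      rw [Finsupp.notMem_support_iff.1 hs]
      simp [hM0]
    change ∏ s ∈ m.support,
        ((Finset.Ico (max 0 (-m s)) (min (M : ℤ) (M - m s))).card : ℝ) / M ≤ _
    rw [hprod, Finset.prod_div_distrib, hcard]
    gcongr
  · refine Eventually.of_forall fun α => div_le_one_of_le₀ ?_ (Nat.cast_nonneg _)
    exact_mod_cast Finset.card_filter_le _ _

lemma finsuppBox_nonempty {ι : Type*} {α : Finset ι × ℕ} (h : 1 ≤ α.2) :
    (finsuppBox α).Nonempty :=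
  ⟨0, by simpa [finsuppBox, Finset.mem_finsupp_iff] using fun _ _ => Nat.lt_of_succ_le h⟩

/-- Bochner-type theorem: if a pair of functions on an abelian group encloses a Gram kernel of
unit vectors on every finite set, then it encloses the Fourier coefficients of a probability
measure on a torus indexed by any family of elements of the group. -/
lemma exists_probabilityMeasure_torus {X ι : Type*} [AddCommGroup X] (y : (ι →₀ ℤ) →+ X)
    (a b : X → ℝ)
    (h : ∀ F : Finset X, ∃ (d : ℕ) (v : X → EuclideanSpace ℝ (Fin d)), (∀ x ∈ F, ‖v x‖ = 1) ∧
      ∀ x ∈ F, ∀ z ∈ F, a (x - z) ≤ inner ℝ (v x) (v z) ∧ inner ℝ (v x) (v z) ≤ b (x - z)) :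
    ∃ ν : ProbabilityMeasure (Torus ι), ∀ m,
      a (y m) ≤ ∫ ω, (Torus.char ι (.ofAdd m) ω : ℂ).re ∂(ν : Measure (Torus ι)) ∧
        ∫ ω, (Torus.char ι (.ofAdd m) ω : ℂ).re ∂(ν : Measure (Torus ι)) ≤ b (y m) := by
  classical
  have key : ∀ α : Finset ι × ℕ, ∃ μ : ProbabilityMeasure (Torus ι), 1 ≤ α.2 → ∀ m,
      ((finsuppBox α).filter (fun k => k + m ∈ finsuppBox α)).card / ((finsuppBox α).card : ℝ) *
          a (y m) ≤ ∫ ω, (Torus.char ι (.ofAdd m) ω : ℂ).re ∂(μ : Measure (Torus ι)) ∧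
        ∫ ω, (Torus.char ι (.ofAdd m) ω : ℂ).re ∂(μ : Measure (Torus ι)) ≤
        ((finsuppBox α).filter (fun k => k + m ∈ finsuppBox α)).card / ((finsuppBox α).card : ℝ) *
          b (y m) := by
    intro α
    by_cases hα : 1 ≤ α.2
    swap
    · exact ⟨⟨Torus.haar ι, inferInstance⟩, fun h => absurd h hα⟩
    obtain ⟨d, v, hv1, hv2⟩ := h ((finsuppBox α).image y)
    obtain ⟨μ, hμ⟩ := exists_probabilityMeasure_integral_re (Torus.haar ι) (Torus.char ι)
      Torus.continuous_char (fun m => Torus.integral_re_char) (finsuppBox α)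
      (finsuppBox_nonempty hα) (fun k => v (y k))
      (fun k hk => hv1 _ (Finset.mem_image_of_mem _ hk))
    refine ⟨μ, fun _ m => ?_⟩
    have hb : ∀ k ∈ (finsuppBox α).filter (fun k => k + m ∈ finsuppBox α),
        a (y m) ≤ inner ℝ (v (y (k + m))) (v (y k)) ∧
          inner ℝ (v (y (k + m))) (v (y k)) ≤ b (y m) := by
      intro k hk
      rw [Finset.mem_filter] at hk
      have := hv2 _ (Finset.mem_image_of_mem y hk.2) _ (Finset.mem_image_of_mem y hk.1)
      rwa [← map_sub, add_sub_cancel_left] at this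
    rw [hμ, div_mul_eq_mul_div, div_mul_eq_mul_div, ← nsmul_eq_mul, ← nsmul_eq_mul]
    constructor
    · gcongr
      exact Finset.card_nsmul_le_sum _ _ _ fun k hk => (hb k hk).1
    · gcongr
      exact Finset.sum_le_card_nsmul _ _ _ fun k hk => (hb k hk).2
  choose μ hμ using key
  let 𝒰 : Ultrafilter (Finset ι × ℕ) := Ultrafilter.of atTop
  have h𝒰 : (𝒰 : Filter (Finset ι × ℕ)) ≤ atTop := Ultrafilter.of_le _
  have hlim : Tendsto μ 𝒰 (𝓝 (𝒰.map μ).lim) := (𝒰.map μ).le_nhds_lim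
  refine ⟨(𝒰.map μ).lim, fun m => ?_⟩
  have hcont : Continuous fun ω => (Torus.char ι (.ofAdd m) ω : ℂ).re :=
    Complex.continuous_re.comp (continuous_subtype_val.comp (Torus.continuous_char _))
  have hInt := (ProbabilityMeasure.tendsto_iff_forall_integral_tendsto.1 hlim)
    (BoundedContinuousFunction.mkOfCompact ⟨_, hcont⟩)
  simp only [BoundedContinuousFunction.mkOfCompact_apply, ContinuousMap.coe_mk] at hInt
  have hr := (tendsto_finsuppBox_overlap m).mono_left h𝒰
  have hev : ∀ᶠ α : Finset ι × ℕ in (𝒰 : Filter (Finset ι × ℕ)), 1 ≤ α.2 := by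
    refine h𝒰 ?_
    filter_upwards [eventually_ge_atTop ((∅, 1) : Finset ι × ℕ)] with α hα using hα.2
  constructor
  · refine le_of_tendsto_of_tendsto (by simpa using hr.mul_const (a (y m))) hInt ?_
    filter_upwards [hev] with α hα using (hμ α hα m).1
  · refine le_of_tendsto_of_tendsto hInt (by simpa using hr.mul_const (b (y m))) ?_
    filter_upwards [hev] with α hα using (hμ α hα m).2

end Folner

section RandomCharacter

lemma Circle.eq_one_of_re_eq_one {z : Circle} (h : (z : ℂ).re = 1) : z = 1 := by
  have hz := Circle.normSq_coe z
  rw [Complex.normSq_apply, h] at hz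
  refine Circle.ext (Complex.ext h ?_)
  simpa using hz

lemma IsCoarseEmbedding.small {X : Type*} [AddCommGroup X] [Module ℝ X] {q : X → ℝ}
    (hq : IsQuasiNorm q) {H : Type} [NormedAddCommGroup H] {f : X → H}
    (hf : IsCoarseEmbedding (fun x y => q (x - y)) f) : Small.{0} X := by
  refine small_of_injective (f := fun x (n : ℕ) => f ((n : ℝ) • x)) fun x y hxy => ?_
  obtain ⟨φ₁, φ₂, -, -, hφ, h⟩ := hf
  by_contra hne
  have hpos : 0 < q (x - y) :=
    (hq.nonneg _).lt_of_ne' (mt (hq.eq_zero_iff _).1 (sub_ne_zero.2 hne))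
  have ht : Tendsto (fun n : ℕ => φ₁ (n * q (x - y))) atTop atTop :=
    hφ.comp (tendsto_natCast_atTop_atTop.atTop_mul_const hpos)
  obtain ⟨n, hn⟩ := (ht.eventually_gt_atTop 0).exists
  have h1 := (h ((n : ℝ) • x) ((n : ℝ) • y)).1
  have h2 : f ((n : ℝ) • x) = f ((n : ℝ) • y) := congrFun hxy n
  dsimp only at h1
  rw [h2, dist_self, ← smul_sub, hq.smul, Nat.abs_cast] at h1
  exact absurd hn (not_lt.2 h1)

/-- A coarse embedding into a Hilbert space yields a random character of the additive group whose
characteristic functional is controlled by the quasi-norm. -/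
lemma IsQuasiNorm.exists_random_character {X : Type*} [AddCommGroup X] [Module ℝ X] {q : X → ℝ}
    (hq : IsQuasiNorm q) {H : Type} [NormedAddCommGroup H] [InnerProductSpace ℝ H] {f : X → H}
    (hf : IsCoarseEmbedding (fun x y => q (x - y)) f) :
    ∃ p : ℝ, 0 < p ∧ ∃ δ : ℝ, 0 < δ ∧ ∃ R : ℝ, 0 < R ∧
      ∃ (Ω : Type) (_ : MeasurableSpace Ω) (μ : Measure Ω), IsProbabilityMeasure μ ∧
      ∃ θ : X → Ω → Circle, (∀ x, Measurable fun ω => (θ x ω : ℂ)) ∧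
        (∀ x y, ∀ᵐ ω ∂μ, θ (x + y) ω = θ x ω * θ y ω) ∧
        (∀ x, 1 - q x ^ p ≤ ∫ ω, (θ x ω : ℂ).re ∂μ) ∧
        ∀ x, R ≤ q x → ∫ ω, (θ x ω : ℂ).re ∂μ ≤ 1 - δ := by
  obtain ⟨p, hp, δ, hδ, R, hR, h⟩ := hq.exists_unit_vectors hf
  have := IsCoarseEmbedding.small hq hf
  classical
  let e := equivShrink.{0} X
  let y : (Shrink.{0} X →₀ ℤ) →+ X := Finsupp.liftAddHom fun s => zmultiplesHom X (e.symm s)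
  have hy : ∀ x, y (Finsupp.single (e x) 1) = x := fun x => by simp [y]
  obtain ⟨ν, hν⟩ := exists_probabilityMeasure_torus y (fun x => 1 - q x ^ p)
    (fun x => if R ≤ q x then 1 - δ else 1) fun F => by
      obtain ⟨d, v, hv1, hv2⟩ := h F
      refine ⟨d, v, hv1, fun x hx z hz => ⟨(hv2 x hx z hz).1, ?_⟩⟩
      split_ifs with hxz
      · exact (hv2 x hx z hz).2 hxz
      · simpa [hv1 x hx, hv1 z hz] using real_inner_le_norm (v x) (v z)
  have hchar : ∀ x ω, Torus.char (Shrink.{0} X) (.ofAdd (Finsupp.single (e x) 1)) ω = ω (e x) := by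
    intro x ω
    rw [Torus.char_apply, Finsupp.prod_single_index (zpow_zero _), zpow_one]
  refine ⟨p, hp, δ, hδ, R, hR, Torus (Shrink.{0} X), inferInstance, ν, inferInstance,
    fun x ω => ω (e x), fun x => (continuous_subtype_val.comp (Torus.continuous_eval _)).measurable, ?_, ?_, ?_⟩
  · intro x z
    set m : Shrink.{0} X →₀ ℤ := Finsupp.single (e (x + z)) 1 - Finsupp.single (e x) 1 -
      Finsupp.single (e z) 1 with hm
    have hym : y m = 0 := by rw [hm, map_sub, map_sub, hy, hy, hy]; abel
    have hcont : Continuous fun ω => 1 - (Torus.char _ (.ofAdd m) ω : ℂ).re :=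
      continuous_const.sub
        (Complex.continuous_re.comp (continuous_subtype_val.comp (Torus.continuous_char _)))
    have hcont' : Continuous fun ω => (Torus.char _ (.ofAdd m) ω : ℂ).re :=
      Complex.continuous_re.comp (continuous_subtype_val.comp (Torus.continuous_char _))
    have hInt : ∀ {g : Torus (Shrink.{0} X) → ℝ}, Continuous g →
        Integrable g (ν : Measure (Torus (Shrink.{0} X))) := fun hg =>
      hg.integrable_of_hasCompactSupport (HasCompactSupport.of_compactSpace _)
    have h0 : ∫ ω, (1 - (Torus.char _ (.ofAdd m) ω : ℂ).re) ∂(ν : Measure (Torus (Shrink.{0} X)))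
        = 0 := by
      rw [integral_sub (integrable_const _) (hInt hcont')]
      have := (hν m).1
      have h2 := (hν m).2
      simp only [hym, (hq.eq_zero_iff 0).2 rfl, Real.zero_rpow hp.ne', not_le.2 hR,
        if_false] at this h2
      simp
      linarith
    rw [integral_eq_zero_iff_of_nonneg (fun ω => ?_) (hInt hcont)] at h0
    · filter_upwards [h0] with ω hω
      have h1 : Torus.char _ (.ofAdd m) ω = 1 := by
        refine Circle.eq_one_of_re_eq_one ?_
        simp only [Pi.zero_apply] at hω
        linarith
      rw [hm, ofAdd_sub, ofAdd_sub, map_div, map_div, Pi.div_apply, Pi.div_apply, hchar, hchar,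
        hchar, div_div, div_eq_one] at h1
      exact h1
    · simp only [Pi.zero_apply, sub_nonneg]
      exact (Complex.re_le_norm _).trans (Circle.norm_coe _).le
  · intro x
    have := (hν (Finsupp.single (e x) 1)).1
    simpa only [hchar, hy] using this
  · intro x hx
    have := (hν (Finsupp.single (e x) 1)).2
    simpa only [hchar, hy, if_pos hx] using this

end RandomCharacter

section Phase

lemma Circle.arg_mul_of_re_pos {z w : Circle} (hz : 0 < (z : ℂ).re) (hw : 0 < (w : ℂ).re) :
    Complex.arg (z * w : Circle) = Complex.arg z + Complex.arg w := by
  have h1 := abs_lt.1 (Complex.abs_arg_lt_pi_div_two_iff.2 (.inl hz))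
  have h2 := abs_lt.1 (Complex.abs_arg_lt_pi_div_two_iff.2 (.inl hw))
  rw [Circle.coe_mul]
  exact Complex.arg_mul z.coe_ne_zero w.coe_ne_zero ⟨by linarith, by linarith⟩

lemma Circle.cos_arg (z : Circle) : Real.cos (Complex.arg z) = (z : ℂ).re := by
  rw [Complex.cos_arg z.coe_ne_zero, Circle.norm_coe, div_one]

lemma Circle.cos_le_of_le_abs_arg {z : Circle} {ε : ℝ} (hε : 0 ≤ ε)
    (h : ε ≤ |Complex.arg z|) : (z : ℂ).re ≤ Real.cos ε := by
  rw [← Circle.cos_arg, ← Real.cos_abs (Complex.arg z)]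
  exact Real.cos_le_cos_of_nonneg_of_le_pi hε (Complex.abs_arg_le_pi _) h

lemma Circle.two_pow_mul_arg_eq {z : ℕ → Circle} (hz : ∀ j, z j = z (j + 1) * z (j + 1)) {N : ℕ}
    (hN : ∀ j > N, 0 < (z j : ℂ).re) {j : ℕ} (hj : N ≤ j) :
    (2 : ℝ) ^ j * Complex.arg (z j) = 2 ^ N * Complex.arg (z N) := by
  induction j, hj using Nat.le_induction with
  | base => rfl
  | succ j hj ih =>
    have h := hN (j + 1) (Nat.lt_succ_of_le hj)
    rw [← ih, hz j, Circle.arg_mul_of_re_pos h h]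
    ring

lemma Circle.exp_two_pow_mul_arg {z : ℕ → Circle} (hz : ∀ j, z j = z (j + 1) * z (j + 1))
    (j : ℕ) : Circle.exp (2 ^ j * Complex.arg (z j)) = z 0 := by
  have h : ∀ j, z j ^ 2 ^ j = z 0 := by
    intro j
    induction j with
    | zero => simp
    | succ j ih => rw [← ih, hz j, pow_succ' 2 j, pow_mul, pow_two]
  have h2 := Circle.exp_nsmul (Complex.arg (z j)) (2 ^ j)
  rw [Circle.exp_arg, h, nsmul_eq_mul] at h2
  rw [← h2]
  norm_cast

variable {X : Type*} {q : X → ℝ} {p : ℝ} {Ω : Type*}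
  [MeasurableSpace Ω] {μ : Measure Ω} [IsProbabilityMeasure μ] {θ : X → Ω → Circle}

lemma Circle.integrable_re {z : Ω → Circle} (hz : Measurable fun ω => (z ω : ℂ)) :
    Integrable (fun ω => (z ω : ℂ).re) μ :=
  Integrable.of_bound (Complex.measurable_re.comp hz).aestronglyMeasurable 1
    (Eventually.of_forall fun _ => (Complex.abs_re_le_norm _).trans (Circle.norm_coe _).le)

lemma measureReal_le_one_sub_re_le (hm : ∀ x, Measurable fun ω => (θ x ω : ℂ))
    (hlow : ∀ x, 1 - q x ^ p ≤ ∫ ω, (θ x ω : ℂ).re ∂μ) {c : ℝ} (hc : 0 < c) (x : X) :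
    μ.real {ω | c ≤ 1 - (θ x ω : ℂ).re} ≤ q x ^ p / c := by
  have hi := Circle.integrable_re (μ := μ) (hm x)
  have h := mul_meas_ge_le_integral_of_nonneg (μ := μ) (f := fun ω => 1 - (θ x ω : ℂ).re)
    (Eventually.of_forall fun ω =>
      sub_nonneg.2 ((Complex.re_le_norm _).trans (Circle.norm_coe _).le))
    ((integrable_const _).sub hi) c
  rw [integral_sub (integrable_const _) hi] at h
  rw [le_div_iff₀' hc]
  refine h.trans ?_
  have := hlow x
  simp
  linarith

variable [AddCommGroup X] [Module ℝ X]

lemma IsQuasiNorm.rpow_two_pow_inv_smul (hq : IsQuasiNorm q) (x : X) (j : ℕ) :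
    q (((2 : ℝ) ^ j)⁻¹ • x) ^ p = ((2 : ℝ)⁻¹ ^ p) ^ j * q x ^ p := by
  rw [hq.smul, abs_of_nonneg (by positivity), Real.mul_rpow (by positivity) (hq.nonneg _),
    ← inv_pow, ← Real.rpow_natCast, ← Real.rpow_natCast, ← Real.rpow_mul (by positivity),
    ← Real.rpow_mul (by positivity), mul_comm p]

lemma measure_re_nonpos_le (hq : IsQuasiNorm q) (hm : ∀ x, Measurable fun ω => (θ x ω : ℂ))
    (hlow : ∀ x, 1 - q x ^ p ≤ ∫ ω, (θ x ω : ℂ).re ∂μ) (x : X) (j : ℕ) :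
    μ {ω | (θ (((2 : ℝ) ^ j)⁻¹ • x) ω : ℂ).re ≤ 0} ≤
      ENNReal.ofReal (((2 : ℝ)⁻¹ ^ p) ^ j * q x ^ p) := by
  have h := measureReal_le_one_sub_re_le hm hlow one_pos (((2 : ℝ) ^ j)⁻¹ • x)
  rw [hq.rpow_two_pow_inv_smul, div_one] at h
  rw [← ofReal_measureReal]
  refine ENNReal.ofReal_le_ofReal (le_trans (le_of_eq ?_) h)
  congr 1
  ext ω
  simp

/-- A random character which is continuous at zero in probability lifts to a real-valued phase. -/
lemma IsQuasiNorm.exists_phase (hq : IsQuasiNorm q) (hp : 0 < p)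
    (hm : ∀ x, Measurable fun ω => (θ x ω : ℂ))
    (hadd : ∀ x y, ∀ᵐ ω ∂μ, θ (x + y) ω = θ x ω * θ y ω)
    (hlow : ∀ x, 1 - q x ^ p ≤ ∫ ω, (θ x ω : ℂ).re ∂μ) (x : X) :
    ∃ V : Ω → ℝ, Measurable V ∧ ∀ᵐ ω ∂μ,
      (∀ᶠ j : ℕ in atTop, 0 < (θ (((2 : ℝ) ^ j)⁻¹ • x) ω : ℂ).re) ∧
      (∀ N : ℕ, (∀ j > N, 0 < (θ (((2 : ℝ) ^ j)⁻¹ • x) ω : ℂ).re) →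
        V ω = 2 ^ N * Complex.arg (θ (((2 : ℝ) ^ N)⁻¹ • x) ω)) ∧
      Circle.exp (V ω) = θ x ω := by
  have hr0 : 0 < (2 : ℝ)⁻¹ ^ p := by positivity
  have hr1 : (2 : ℝ)⁻¹ ^ p < 1 := Real.rpow_lt_one (by norm_num) (by norm_num) hp
  have hstep : ∀ᵐ ω ∂μ, ∀ j : ℕ, θ (((2 : ℝ) ^ j)⁻¹ • x) ω =
      θ (((2 : ℝ) ^ (j + 1))⁻¹ • x) ω * θ (((2 : ℝ) ^ (j + 1))⁻¹ • x) ω := by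
    rw [ae_all_iff]
    intro j
    filter_upwards [hadd (((2 : ℝ) ^ (j + 1))⁻¹ • x) (((2 : ℝ) ^ (j + 1))⁻¹ • x)] with ω hω
    rw [← hω, ← add_smul]
    congr 3
    rw [pow_succ]
    field_simp
    norm_num
  have hpos : ∀ᵐ ω ∂μ, ∀ᶠ j : ℕ in atTop, 0 < (θ (((2 : ℝ) ^ j)⁻¹ • x) ω : ℂ).re := by
    have hsum : ∑' j : ℕ, μ {ω | (θ (((2 : ℝ) ^ j)⁻¹ • x) ω : ℂ).re ≤ 0} ≠ ⊤ := by
      refine ne_top_of_le_ne_top ?_ (ENNReal.tsum_le_tsum fun j => measure_re_nonpos_le hq hm hlow x j)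
      exact ((summable_geometric_of_lt_one hr0.le hr1).mul_right _).tsum_ofReal_ne_top
    filter_upwards [ae_eventually_notMem hsum] with ω hω
    filter_upwards [hω] with j hj
    simpa using hj
  have hlim : ∀ᵐ ω ∂μ, ∃ l : ℝ, Tendsto
      (fun j : ℕ => (2 : ℝ) ^ j * Complex.arg (θ (((2 : ℝ) ^ j)⁻¹ • x) ω)) atTop (𝓝 l) := by
    filter_upwards [hstep, hpos] with ω h1 h2
    obtain ⟨N, hN⟩ := eventually_atTop.1 h2
    refine ⟨_, tendsto_atTop_of_eventually_const (i₀ := N) fun j hj =>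
      Circle.two_pow_mul_arg_eq h1 (fun j hj => hN j hj.le) hj⟩
  obtain ⟨V, hV, hVlim⟩ := measurable_limit_of_tendsto_metrizable_ae (μ := μ) (L := atTop)
    (f := fun (j : ℕ) ω => (2 : ℝ) ^ j * Complex.arg (θ (((2 : ℝ) ^ j)⁻¹ • x) ω))
    (fun j => ((Complex.measurable_arg.comp (hm _)).const_mul _).aemeasurable) hlim
  refine ⟨V, hV, ?_⟩
  filter_upwards [hstep, hpos, hVlim] with ω h1 h2 h3
  refine ⟨h2, fun N hN => tendsto_nhds_unique h3 ?_, ?_⟩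
  · exact tendsto_atTop_of_eventually_const (i₀ := N) fun j hj =>
      Circle.two_pow_mul_arg_eq h1 hN hj
  · have h4 := (Circle.exp.continuous.tendsto _).comp h3
    refine tendsto_nhds_unique h4 (tendsto_const_nhds.congr fun j => ?_)
    have := Circle.exp_two_pow_mul_arg h1 j
    simpa using this.symm

end Phase

section Linearize

lemma tendsto_integral_comp_of_tendstoInMeasure {Ω : Type*} [MeasurableSpace Ω] {μ : Measure Ω}
    [IsProbabilityMeasure μ] {f : ℕ → Ω → ℝ} (hf : ∀ n, Measurable (f n))
    (h : TendstoInMeasure μ f atTop (0 : Ω → ℝ)) {g : ℝ → ℝ} (hg : Continuous g) {C : ℝ}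
    (hC : ∀ t, |g t| ≤ C) : Tendsto (fun n => ∫ ω, g (f n ω) ∂μ) atTop (𝓝 (g 0)) := by
  refine tendsto_of_subseq_tendsto fun ns hns => ?_
  obtain ⟨ms, hms, hae⟩ := (h.comp hns).exists_seq_tendsto_ae
  refine ⟨ms, ?_⟩
  have hlim := tendsto_integral_of_dominated_convergence (μ := μ)
    (F := fun n ω => g (f (ns (ms n)) ω)) (f := fun _ => g 0) (fun _ => C)
    (fun n => (hg.measurable.comp (hf _)).aestronglyMeasurable) (integrable_const _)
    (fun n => Eventually.of_forall fun ω => hC _)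
    (by filter_upwards [hae] with ω hω using (hg.tendsto _).comp hω)
  simpa using hlim

/-- A linear map into `L₀` lifts to a linear map into the space of measurable functions. -/
lemma exists_linearMap_measurable_ae_eq {X Ω : Type*} [AddCommGroup X] [Module ℝ X]
    [MeasurableSpace Ω] {μ : Measure Ω} {V : X → Ω → ℝ} (hV : ∀ x, Measurable (V x))
    (hadd : ∀ x y, V (x + y) =ᵐ[μ] V x + V y) (hsmul : ∀ (c : ℝ) x, V (c • x) =ᵐ[μ] c • V x) :
    ∃ U : X →ₗ[ℝ] (Ω → ℝ), ∀ x, Measurable (U x) ∧ U x =ᵐ[μ] V x := by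
  let b := Module.Basis.ofVectorSpace ℝ X
  refine ⟨b.constr ℝ fun i => V (b i), fun x => ?_⟩
  have hx : x ∈ Submodule.span ℝ (Set.range b) := b.span_eq ▸ Submodule.mem_top
  induction hx using Submodule.span_induction with
  | mem x hx =>
    obtain ⟨i, rfl⟩ := hx
    rw [b.constr_basis]
    exact ⟨hV _, EventuallyEq.rfl⟩
  | zero =>
    rw [map_zero]
    refine ⟨measurable_zero, ?_⟩
    have := hsmul 0 0
    rw [zero_smul, zero_smul] at this
    exact this.symm
  | add x y _ _ hx hy =>
    rw [map_add]
    exact ⟨hx.1.add hy.1, (hx.2.add hy.2).trans (hadd x y).symm⟩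
  | smul c x _ hx =>
    rw [map_smul]
    exact ⟨hx.1.const_smul c, (hx.2.const_smul c).trans (hsmul c x).symm⟩

variable {X : Type*} [AddCommGroup X] [Module ℝ X] {q : X → ℝ} {Ω : Type*}
  [MeasurableSpace Ω] {μ : Measure Ω} [IsProbabilityMeasure μ]

/-- An additive map into `L₀` which is continuous at zero is homogeneous. -/
lemma IsQuasiNorm.ae_smul_of_ae_add (hq : IsQuasiNorm q) {V : X → Ω → ℝ}
    (hV : ∀ x, Measurable (V x)) (hadd : ∀ x y, V (x + y) =ᵐ[μ] V x + V y)
    (hcont : ∀ u : ℕ → X, Tendsto (fun n => q (u n)) atTop (𝓝 0) →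
      TendstoInMeasure μ (fun n => V (u n)) atTop (0 : Ω → ℝ)) (c : ℝ) (x : X) :
    V (c • x) =ᵐ[μ] c • V x := by
  let W : X →+ (Ω →ₘ[μ] ℝ) := AddMonoidHom.mk'
    (fun x => AEEqFun.mk (V x) (hV x).aestronglyMeasurable) fun x y => by
      rw [AEEqFun.mk_add_mk, AEEqFun.mk_eq_mk]
      exact hadd x y
  have hrat : ∀ (r : ℚ) (x : X), V ((r : ℝ) • x) =ᵐ[μ] (r : ℝ) • V x := by
    intro r x
    have h := map_ratCast_smul W ℝ ℝ r x
    have h1 : AEEqFun.mk (V ((r : ℝ) • x)) (hV _).aestronglyMeasurable =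
      (r : ℝ) • AEEqFun.mk (μ := μ) (V x) (hV x).aestronglyMeasurable := h
    rwa [AEEqFun.smul_mk, AEEqFun.mk_eq_mk] at h1
  obtain ⟨r, hr⟩ : ∃ r : ℕ → ℚ, Tendsto (fun n => (r n : ℝ)) atTop (𝓝 c) := by
    have := Rat.denseRange_cast (𝕜 := ℝ) |>.closure_range ▸ Set.mem_univ c
    obtain ⟨s, hs, hlim⟩ := mem_closure_iff_seq_limit.1 this
    choose r hr using hs
    exact ⟨r, by simpa only [hr] using hlim⟩
  have h0 : Tendsto (fun n => q ((c - r n) • x)) atTop (𝓝 0) := by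
    simp only [hq.smul]
    have := ((tendsto_const_nhds (x := c)).sub hr).abs.mul_const (q x)
    simpa using this
  have h1 := hcont _ h0
  have h2 : TendstoInMeasure μ (fun n => V (c • x) - (r n : ℝ) • V x) atTop (0 : Ω → ℝ) := by
    refine h1.congr (fun n => ?_) EventuallyEq.rfl
    filter_upwards [hadd ((c - r n) • x) ((r n : ℝ) • x), hrat (r n) x] with ω h3 h4
    rw [← add_smul, sub_add_cancel] at h3
    simp only [Pi.sub_apply, Pi.add_apply] at h3 ⊢
    rw [h3, h4]
    ring
  have h3 : TendstoInMeasure μ (fun n => V (c • x) - (r n : ℝ) • V x) atTop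
      (V (c • x) - c • V x) := by
    refine tendstoInMeasure_of_tendsto_ae
      (fun n => ((hV _).sub ((hV x).const_smul _)).aestronglyMeasurable)
      (Eventually.of_forall fun ω => ?_)
    simp only [Pi.sub_apply, Pi.smul_apply, smul_eq_mul]
    exact tendsto_const_nhds.sub (hr.mul_const _)
  filter_upwards [tendstoInMeasure_ae_unique h3 h2] with ω hω
  simpa [sub_eq_zero] using hω

variable {p : ℝ} {θ : X → Ω → Circle}

lemma IsQuasiNorm.tendstoInMeasure_phase (hq : IsQuasiNorm q) (hp : 0 < p)
    (hm : ∀ x, Measurable fun ω => (θ x ω : ℂ))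
    (hlow : ∀ x, 1 - q x ^ p ≤ ∫ ω, (θ x ω : ℂ).re ∂μ) {V : X → Ω → ℝ}
    (hV : ∀ x, ∀ᵐ ω ∂μ, (∀ j > 0, 0 < (θ (((2 : ℝ) ^ j)⁻¹ • x) ω : ℂ).re) →
      V x ω = Complex.arg (θ x ω))
    {u : ℕ → X} (hu : Tendsto (fun n => q (u n)) atTop (𝓝 0)) :
    TendstoInMeasure μ (fun n => V (u n)) atTop (0 : Ω → ℝ) := by
  rw [tendstoInMeasure_iff_norm]
  intro ε hε
  have hr0 : 0 < (2 : ℝ)⁻¹ ^ p := by positivity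
  have hr1 : (2 : ℝ)⁻¹ ^ p < 1 := Real.rpow_lt_one (by norm_num) (by norm_num) hp
  have hsum := (summable_geometric_of_lt_one hr0.le hr1)
  set η := min ε Real.pi with hη
  have hη0 : 0 < η := lt_min hε Real.pi_pos
  have hc : 0 < 1 - Real.cos η := by
    rw [sub_pos, ← Real.cos_zero]
    exact Real.cos_lt_cos_of_nonneg_of_le_pi le_rfl (min_le_right _ _) hη0
  have hbound : ∀ x, μ {ω | ε ≤ ‖V x ω - (0 : Ω → ℝ) ω‖} ≤
      ENNReal.ofReal ((∑' j : ℕ, ((2 : ℝ)⁻¹ ^ p) ^ (j + 1)) * q x ^ p) +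
        ENNReal.ofReal (q x ^ p / (1 - Real.cos η)) := by
    intro x
    have h1 : μ {ω | ε ≤ ‖V x ω - (0 : Ω → ℝ) ω‖} ≤
        μ ((⋃ j : ℕ, {ω | (θ (((2 : ℝ) ^ (j + 1))⁻¹ • x) ω : ℂ).re ≤ 0}) ∪
          {ω | 1 - Real.cos η ≤ 1 - (θ x ω : ℂ).re}) := by
      refine measure_mono_ae ?_
      filter_upwards [hV x] with ω hω h
      by_contra hne
      have hne' := not_or.1 hne
      simp only [Set.mem_iUnion, not_exists] at hne'
      have h2 := hω fun j hj => by
        have := hne'.1 (j - 1)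
        rw [Nat.sub_add_cancel hj] at this
        exact not_le.1 this
      refine hne'.2 (sub_le_sub_left (Circle.cos_le_of_le_abs_arg hη0.le ?_) _)
      rw [← h2]
      have h3 : ε ≤ |V x ω| := by simpa using! h
      exact (min_le_left _ _).trans h3
    refine h1.trans ((measure_union_le _ _).trans (add_le_add ?_ ?_))
    · refine (measure_iUnion_le _).trans
        ((ENNReal.tsum_le_tsum fun j => measure_re_nonpos_le hq hm hlow x (j + 1)).trans ?_)
      rw [← tsum_mul_right, ENNReal.ofReal_tsum_of_nonneg]
      · exact fun j => mul_nonneg (by positivity) (Real.rpow_nonneg (hq.nonneg _) _)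
      · exact ((summable_nat_add_iff 1).2 hsum).mul_right _
    · rw [← ofReal_measureReal]
      exact ENNReal.ofReal_le_ofReal (measureReal_le_one_sub_re_le hm hlow hc x)
  have hq0 : Tendsto (fun n => q (u n) ^ p) atTop (𝓝 0) := by
    have := hu.rpow_const (p := p) (.inr hp.le)
    rwa [Real.zero_rpow hp.ne'] at this
  refine tendsto_of_tendsto_of_tendsto_of_le_of_le tendsto_const_nhds ?_ (fun _ => zero_le)
    fun n => hbound (u n)
  have h1 := ENNReal.tendsto_ofReal (hq0.const_mul (∑' j : ℕ, ((2 : ℝ)⁻¹ ^ p) ^ (j + 1)))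
  have h2 := ENNReal.tendsto_ofReal (hq0.div_const (1 - Real.cos η))
  simpa using h1.add h2

end Linearize

section Forward

theorem IsQuasiNorm.linIsoSubspaceL0_of_coarselyEmbeds {X : Type*} [AddCommGroup X] [Module ℝ X]
    {q : X → ℝ} (hq : IsQuasiNorm q) (h : CoarselyEmbedsIntoHilbert X q) :
    LinIsoSubspaceL0 X q := by
  obtain ⟨H, f, hf⟩ := h
  obtain ⟨p, hp, δ, hδ, R, hR, Ω, _, μ, hμ, θ, hm, hadd, hlow, hup⟩ := hq.exists_random_character hf
  choose V hVm hV using fun x => hq.exists_phase hp hm hadd hlow x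
  have hVcont : ∀ u : ℕ → X, Tendsto (fun n => q (u n)) atTop (𝓝 0) →
      TendstoInMeasure μ (fun n => V (u n)) atTop (0 : Ω → ℝ) := by
    refine fun u hu => hq.tendstoInMeasure_phase hp hm hlow (fun x => ?_) hu
    filter_upwards [hV x] with ω hω h
    simpa using hω.2.1 0 h
  have hVadd : ∀ x y, V (x + y) =ᵐ[μ] V x + V y := by
    intro x y
    have h1 : ∀ᵐ ω ∂μ, ∀ j : ℕ, θ (((2 : ℝ) ^ j)⁻¹ • (x + y)) ω =
        θ (((2 : ℝ) ^ j)⁻¹ • x) ω * θ (((2 : ℝ) ^ j)⁻¹ • y) ω := by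
      rw [ae_all_iff]
      intro j
      simpa only [smul_add] using hadd (((2 : ℝ) ^ j)⁻¹ • x) (((2 : ℝ) ^ j)⁻¹ • y)
    filter_upwards [h1, hV x, hV y, hV (x + y)] with ω h1 hx hy hxy
    obtain ⟨N, hN⟩ := eventually_atTop.1 (hx.1.and (hy.1.and hxy.1))
    rw [Pi.add_apply, hx.2.1 N fun j hj => (hN j hj.le).1,
      hy.2.1 N fun j hj => (hN j hj.le).2.1, hxy.2.1 N fun j hj => (hN j hj.le).2.2, h1,
      Circle.arg_mul_of_re_pos (hN N le_rfl).1 (hN N le_rfl).2.1]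
    ring
  obtain ⟨U, hU⟩ := exists_linearMap_measurable_ae_eq hVm hVadd
    (hq.ae_smul_of_ae_add hVm hVadd hVcont)
  have hcos : ∀ x, ∫ ω, Real.cos (U x ω) ∂μ = ∫ ω, (θ x ω : ℂ).re ∂μ := by
    intro x
    refine integral_congr_ae ?_
    filter_upwards [(hU x).2, hV x] with ω h1 h2
    rw [h1, ← h2.2.2, Circle.coe_exp, Complex.exp_ofReal_mul_I_re]
  have hiff : ∀ u : ℕ → X, Tendsto (fun n => q (u n)) atTop (𝓝 0) ↔
      TendstoInMeasure μ (fun n => U (u n)) atTop (0 : Ω → ℝ) := by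
    intro u
    refine ⟨fun hu => (hVcont u hu).congr (fun n => (hU _).2.symm) EventuallyEq.rfl, fun hu => ?_⟩
    by_contra hne
    obtain ⟨ε, hε, hfreq⟩ : ∃ ε > 0, ∃ᶠ n in atTop, ε ≤ q (u n) := by
      simp only [Metric.tendsto_nhds, not_forall] at hne
      obtain ⟨ε, hε, h⟩ := hne
      refine ⟨ε, hε, (not_eventually.1 h).mono fun n hn => ?_⟩
      simpa [Real.dist_eq, abs_of_nonneg (hq.nonneg _)] using hn
    have hlim := tendsto_integral_comp_of_tendstoInMeasure (fun n => (hU (u n)).1) hu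
      (g := fun t => Real.cos (R / ε * t)) (by fun_prop) (C := 1)
      (fun t => Real.abs_cos_le_one _)
    rw [mul_zero, Real.cos_zero] at hlim
    obtain ⟨n, hn, hn'⟩ := (hfreq.and_eventually
      (hlim.eventually_const_lt (sub_lt_self 1 hδ))).exists
    have h1 := hup ((R / ε) • u n) (by
      rw [hq.smul, abs_of_pos (by positivity)]
      calc R = R / ε * ε := by field_simp
        _ ≤ _ := by gcongr)
    rw [← hcos, map_smul] at h1
    exact absurd hn' (not_lt.2 h1)
  refine ⟨Ω, inferInstance, μ, hμ, U, fun x => (hU x).1, ?_, hiff⟩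
  rw [← LinearMap.ker_eq_bot, LinearMap.ker_eq_bot']
  intro x hx
  have h0 := (hiff fun _ => x).2 (by
    simp only [hx]
    exact tendstoInMeasure_of_tendsto_ae (fun _ => aestronglyMeasurable_zero)
      (Eventually.of_forall fun _ => tendsto_const_nhds))
  exact (hq.eq_zero_iff x).1 (tendsto_nhds_unique tendsto_const_nhds h0)

end Forward

section Backward

lemma isCoarseEmbedding_of_forall_exists {X H : Type*} [PseudoMetricSpace H] {d : X → X → ℝ}
    {f : X → H} {φ : ℝ → ℝ} (hφ : Monotone φ) (hup : ∀ x y, dist (f x) (f y) ≤ φ (d x y))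
    (hlow : ∀ b : ℝ, ∃ A : ℝ, ∀ x y, A ≤ d x y → b ≤ dist (f x) (f y)) :
    IsCoarseEmbedding d f := by
  let S : ℝ → Set ℝ := fun r => insert r {t | ∃ x y, r ≤ d x y ∧ dist (f x) (f y) = t}
  have hS : ∀ r, (S r).Nonempty := fun r => ⟨r, .inl rfl⟩
  have hb : ∀ r, BddBelow (S r) := by
    refine fun r => ⟨min r 0, ?_⟩
    rintro t (rfl | ⟨x, y, -, rfl⟩)
    · exact min_le_left _ _
    · exact (min_le_right _ _).trans dist_nonneg
  refine ⟨fun r => sInf (S r), φ, fun r s hrs => le_csInf (hS s) ?_, hφ, ?_, fun x y =>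
    ⟨csInf_le (hb _) (.inr ⟨x, y, le_rfl, rfl⟩), hup x y⟩⟩
  · rintro t (rfl | ⟨x, y, hxy, rfl⟩)
    · exact (csInf_le (hb r) (.inl rfl)).trans hrs
    · exact csInf_le (hb r) (.inr ⟨x, y, hrs.trans hxy, rfl⟩)
  · refine tendsto_atTop.2 fun b => ?_
    obtain ⟨A, hA⟩ := hlow b
    filter_upwards [eventually_ge_atTop A, eventually_ge_atTop b] with r hrA hrb
    refine le_csInf (hS r) ?_
    rintro t (rfl | ⟨x, y, hxy, rfl⟩)
    · exact hrb
    · exact hA x y (hrA.trans hxy)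

lemma not_finiteDimensional_lp_nat {E : Type*} [NormedAddCommGroup E] [InnerProductSpace ℝ E]
    {e : E} (he : ‖e‖ = 1) : ¬ FiniteDimensional ℝ (lp (fun _ : ℕ => E) 2) := by
  intro h
  have ho : Orthonormal ℝ fun n : ℕ => lp.single (E := fun _ : ℕ => E) 2 n e := by
    classical
    rw [orthonormal_iff_ite]
    intro i j
    rw [lp.inner_single_left, lp.single_apply]
    split_ifs with hij
    · subst hij
      simp [he]
    · rw [Pi.single_eq_of_ne hij, inner_zero_right]
  have := ho.linearIndependent.finite
  exact not_finite ℕ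

/-- A map into a Hilbert space inducing an invariant distance equivalent to the topology near
zero and bounded below far from zero yields a coarse embedding. -/
lemma IsQuasiNorm.coarselyEmbeds_of_invariant_kernel {X : Type*} [AddCommGroup X] [Module ℝ X]
    {q : X → ℝ} (hq : IsQuasiNorm q) {H : Type} [NormedAddCommGroup H] [InnerProductSpace ℝ H]
    [CompleteSpace H] {F : X → H} {κ : X → ℝ} (hF0 : ‖F 0‖ = 1)
    (hF : ∀ x y, ‖F x - F y‖ ^ 2 = κ (x - y)) (hκ2 : ∀ x, κ x ≤ 2)
    (hcont : ∀ ε > 0, ∃ η > 0, ∀ x, q x ≤ η → κ x ≤ ε)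
    (hlow : ∃ δ > 0, ∀ x, 1 ≤ q x → δ ≤ κ x) : CoarselyEmbedsIntoHilbert X q := by
  have hs : ∀ n : ℕ, ∃ s : ℝ, 0 < s ∧ ∀ x, q x ≤ n → κ (s • x) ≤ (1 / 2) ^ n := by
    intro n
    obtain ⟨η, hη, h⟩ := hcont ((1 / 2) ^ n) (by positivity)
    refine ⟨η / (n + 1), by positivity, fun x hx => h _ ?_⟩
    rw [hq.smul, abs_of_pos (by positivity), div_mul_eq_mul_div, div_le_iff₀ (by positivity)]
    have : q x ≤ n + 1 := by linarith
    gcongr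
  choose s hs0 hs using hs
  obtain ⟨δ, hδ, hlow⟩ := hlow
  have hκ0 : ∀ x, 0 ≤ κ x := fun x => by
    rw [← sub_zero x, ← hF]
    positivity
  have hterm : ∀ x (n : ℕ), κ (s n • x) ≤ (if n < ⌈q x⌉₊ then 2 else 0) + (1 / 2) ^ n := by
    intro x n
    split_ifs with h
    · exact (hκ2 _).trans (le_add_of_nonneg_right (by positivity))
    · rw [zero_add]
      exact hs n x ((Nat.le_ceil _).trans (by exact_mod_cast not_lt.1 h))
  have hmaj : ∀ x, HasSum (fun n : ℕ => (if n < ⌈q x⌉₊ then (2 : ℝ) else 0) + (1 / 2) ^ n)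
      (2 * ⌈q x⌉₊ + 2) := by
    intro x
    refine HasSum.add ?_ hasSum_geometric_two
    have : HasSum (fun n : ℕ => if n < ⌈q x⌉₊ then (2 : ℝ) else 0)
        (∑ n ∈ Finset.range ⌈q x⌉₊, if n < ⌈q x⌉₊ then (2 : ℝ) else 0) :=
      hasSum_sum_of_ne_finset_zero fun n hn => if_neg (by simpa using hn)
    convert! this using 1
    rw [Finset.sum_congr rfl fun n hn => if_pos (Finset.mem_range.1 hn)]
    simp [mul_comm]
  have hsummable : ∀ x, Summable fun n => κ (s n • x) := fun x =>
    Summable.of_nonneg_of_le (fun _ => hκ0 _) (hterm x) (hmaj x).summable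
  have hmem : ∀ x, Memℓp (fun n => F (s n • x) - F 0) 2 := by
    intro x
    refine memℓp_gen ((hsummable x).congr fun n => ?_)
    rw [ENNReal.toReal_ofNat, Real.rpow_ofNat, hF, sub_zero]
  let f : X → lp (fun _ : ℕ => H) 2 := fun x => ⟨fun n => F (s n • x) - F 0, hmem x⟩
  have hdist : ∀ x y, dist (f x) (f y) ^ 2 = ∑' n, κ (s n • (x - y)) := by
    intro x y
    rw [dist_eq_norm, ← real_inner_self_eq_norm_sq, lp.inner_eq_tsum]
    refine tsum_congr fun n => ?_
    rw [real_inner_self_eq_norm_sq, smul_sub, ← hF]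
    congr 2
    exact sub_sub_sub_cancel_right _ _ _
  refine ⟨⟨lp (fun _ : ℕ => H) 2, not_finiteDimensional_lp_nat hF0⟩, f,
    isCoarseEmbedding_of_forall_exists (φ := fun r => √(2 * ⌈r⌉₊ + 2)) ?_ ?_ ?_⟩
  · intro a b hab
    have := Nat.ceil_mono hab
    dsimp only
    gcongr
  · intro x y
    refine Real.le_sqrt_of_sq_le ?_
    rw [hdist, ← (hmaj (x - y)).tsum_eq]
    exact (hsummable _).tsum_le_tsum (hterm _) (hmaj _).summable
  · intro b
    obtain ⟨m, hm⟩ := exists_nat_ge (b ^ 2 / δ)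
    refine ⟨∑ n ∈ Finset.range m, (s n)⁻¹, fun x y hxy => ?_⟩
    refine abs_le_of_sq_le_sq' ?_ dist_nonneg |>.2
    rw [hdist]
    calc b ^ 2 ≤ ∑ n ∈ Finset.range m, δ := by
          rw [div_le_iff₀ hδ] at hm
          simpa using hm
      _ ≤ ∑ n ∈ Finset.range m, κ (s n • (x - y)) := by
          refine Finset.sum_le_sum fun n hn => hlow _ ?_
          have h1 : (s n)⁻¹ ≤ q (x - y) := (Finset.single_le_sum
            (f := fun n => (s n)⁻¹) (fun i _ => (inv_pos.2 (hs0 i)).le) hn).trans hxy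
          rw [hq.smul, abs_of_pos (hs0 n)]
          rwa [inv_le_iff_one_le_mul₀' (hs0 n)] at h1
      _ ≤ _ := (hsummable _).sum_le_tsum _ fun _ _ => hκ0 _

open ProbabilityTheory Complex in
/-- Gaussian exponentials realize the kernel `exp (-s² / 2)` on measurable functions. -/
lemma exists_norm_sub_sq_eq_integral_exp {X : Type*} [AddCommGroup X] [Module ℝ X] {Ω : Type}
    [MeasurableSpace Ω] (μ : Measure Ω) [IsProbabilityMeasure μ] (U : X →ₗ[ℝ] (Ω → ℝ))
    (hU : ∀ x, Measurable (U x)) :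
    ∃ F : X → Lp ℂ 2 (μ.prod (gaussianReal 0 1)), ‖F 0‖ = 1 ∧
      ∀ x y, ‖F x - F y‖ ^ 2 = ∫ ω, (2 - 2 * Real.exp (-(U (x - y) ω) ^ 2 / 2)) ∂μ := by
  set P := μ.prod (gaussianReal 0 1)
  let g : X → Ω × ℝ → ℂ := fun x z => cexp ((z.2 * U x z.1 : ℝ) * I)
  have hgm : ∀ x, Measurable (g x) := fun x => by
    have := hU x
    fun_prop
  have hg : ∀ x, MemLp (g x) 2 P := fun x =>
    MemLp.of_bound (hgm x).aestronglyMeasurable 1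
      (Eventually.of_forall fun z => (norm_exp_ofReal_mul_I _).le)
  have hnorm : ∀ {h : Ω × ℝ → ℂ} (hh : MemLp h 2 P), ‖hh.toLp‖ ^ 2 = ∫ z, ‖h z‖ ^ 2 ∂P := by
    intro h hh
    rw [← real_inner_self_eq_norm_sq, L2.inner_def]
    refine integral_congr_ae ?_
    filter_upwards [hh.coeFn_toLp] with z hz
    rw [hz, real_inner_self_eq_norm_sq]
  have hcos : ∀ s : ℝ, ∫ t, Real.cos (t * s) ∂(gaussianReal 0 1) = Real.exp (-s ^ 2 / 2) := by
    intro s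
    have h := congrArg re (charFun_gaussianReal (μ := 0) (v := 1) s)
    have hi : Integrable (fun t : ℝ => cexp (s * t * I)) (gaussianReal 0 1) :=
      Integrable.of_bound (by fun_prop) 1 (Eventually.of_forall fun t => by
        rw [← ofReal_mul, norm_exp_ofReal_mul_I])
    have hre := integral_re (𝕜 := ℂ) hi
    simp only [RCLike.re_to_complex] at hre
    rw [charFun_apply_real, ← hre] at h
    have he : (s * (0 : ℝ) * I - (1 : NNReal) * s ^ 2 / 2 : ℂ) = ((-s ^ 2 / 2 : ℝ) : ℂ) := by
      push_cast
      ring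
    rw [he, exp_ofReal_re] at h
    rw [← h]
    refine integral_congr_ae (Eventually.of_forall fun t => ?_)
    dsimp only
    rw [← ofReal_mul, exp_ofReal_mul_I_re, mul_comm]
  refine ⟨fun x => (hg x).toLp, ?_, fun x y => ?_⟩
  · refine (pow_eq_one_iff_of_nonneg (norm_nonneg _) two_ne_zero).1 ?_
    rw [hnorm]
    simp [g]
  · rw [← MemLp.toLp_sub, hnorm]
    have h1 : ∀ z, ‖(g x - g y) z‖ ^ 2 = 2 - 2 * Real.cos (z.2 * U (x - y) z.1) := by
      intro z
      have h2 : z.2 * U (x - y) z.1 = z.2 * U x z.1 - z.2 * U y z.1 := by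
        rw [map_sub, Pi.sub_apply, mul_sub]
      rw [h2, Real.cos_sub, ← normSq_eq_norm_sq, normSq_apply]
      simp only [g, Pi.sub_apply, sub_re, sub_im, exp_ofReal_mul_I_re, exp_ofReal_mul_I_im]
      nlinarith [Real.sin_sq_add_cos_sq (z.2 * U x z.1), Real.sin_sq_add_cos_sq (z.2 * U y z.1)]
    simp_rw [h1]
    have hm := hU (x - y)
    have hc : ∀ s : ℝ, Integrable (fun t => Real.cos (t * s)) (gaussianReal 0 1) := fun s =>
      Integrable.of_bound (by fun_prop) 1 (Eventually.of_forall fun t => Real.abs_cos_le_one _)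
    rw [integral_prod]
    · refine integral_congr_ae (Eventually.of_forall fun ω => ?_)
      dsimp only
      rw [integral_sub (integrable_const _) ((hc _).const_mul _), integral_const_mul, hcos]
      simp
    · refine (integrable_const _).sub (Integrable.const_mul ?_ _)
      exact Integrable.of_bound (by fun_prop) 1
        (Eventually.of_forall fun t => Real.abs_cos_le_one _)

theorem IsQuasiNorm.coarselyEmbeds_of_linIsoSubspaceL0 {X : Type*} [AddCommGroup X] [Module ℝ X]
    {q : X → ℝ} (hq : IsQuasiNorm q) (h : LinIsoSubspaceL0 X q) :
    CoarselyEmbedsIntoHilbert X q := by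
  obtain ⟨Ω, _, μ, hμ, U, hU, -, hiff⟩ := h
  obtain ⟨F, hF0, hF⟩ := exists_norm_sub_sq_eq_integral_exp μ U hU
  set g : ℝ → ℝ := fun s => 2 - 2 * Real.exp (-s ^ 2 / 2) with hg
  have hgc : Continuous g := by fun_prop
  have hg0 : ∀ s, 0 ≤ g s := fun s => by
    have : Real.exp (-s ^ 2 / 2) ≤ 1 := Real.exp_le_one_iff.2 (by nlinarith [sq_nonneg s])
    simp only [hg]
    linarith
  have hg2 : ∀ s, g s ≤ 2 := fun s => by
    have := Real.exp_pos (-s ^ 2 / 2)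
    simp only [hg]
    linarith
  have hgi : ∀ x, Integrable (fun ω => g (U x ω)) μ := fun x =>
    Integrable.of_bound (hgc.measurable.comp (hU x)).aestronglyMeasurable 2
      (Eventually.of_forall fun ω => by rw [Real.norm_of_nonneg (hg0 _)]; exact hg2 _)
  refine hq.coarselyEmbeds_of_invariant_kernel (κ := fun x => ∫ ω, g (U x ω) ∂μ) hF0 hF
    (fun x => ?_) ?_ ?_
  · simpa using integral_mono (hgi x) (integrable_const 2) fun ω => hg2 _
  · intro ε hε
    by_contra! hne
    choose u hu1 hu2 using fun n : ℕ => hne (1 / (n + 1)) (by positivity)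
    have h1 : Tendsto (fun n => q (u n)) atTop (𝓝 0) :=
      squeeze_zero (fun n => hq.nonneg _) hu1 tendsto_one_div_add_atTop_nhds_zero_nat
    have h2 := tendsto_integral_comp_of_tendstoInMeasure (fun n => hU (u n)) ((hiff u).1 h1) hgc
      (C := 2) fun t => by rw [abs_of_nonneg (hg0 t)]; exact hg2 t
    have h3 := ge_of_tendsto' h2 fun n => (hu2 n).le
    simp [hg] at h3
    linarith
  · by_contra! hne
    choose u hu1 hu2 using fun n : ℕ => hne (1 / (n + 1)) (by positivity)
    have h1 : Tendsto (fun n => ∫ ω, g (U (u n) ω) ∂μ) atTop (𝓝 0) :=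
      squeeze_zero (fun n => integral_nonneg fun ω => hg0 _) (fun n => (hu2 n).le)
        tendsto_one_div_add_atTop_nhds_zero_nat
    have h2 : TendstoInMeasure μ (fun n => U (u n)) atTop (0 : Ω → ℝ) := by
      rw [tendstoInMeasure_iff_measureReal_norm]
      intro ε hε
      have hgε : 0 < g ε := by
        have : Real.exp (-ε ^ 2 / 2) < 1 := Real.exp_lt_one_iff.2 (by nlinarith [sq_pos_of_pos hε])
        simp only [hg]
        linarith
      refine squeeze_zero (fun n => measureReal_nonneg) (fun n => ?_)
        (by simpa using h1.div_const (g ε))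
      rw [le_div_iff₀' hgε]
      refine le_trans ?_ (mul_meas_ge_le_integral_of_nonneg
        (Eventually.of_forall fun ω => hg0 _) (hgi (u n)) (g ε))
      refine mul_le_mul_of_nonneg_left (measureReal_mono fun ω hω => ?_) hgε.le
      simp only [Set.mem_ofPred_eq, Pi.zero_apply, sub_zero, Real.norm_eq_abs] at hω ⊢
      have : ε ^ 2 ≤ U (u n) ω ^ 2 := by
        rw [← sq_abs (U (u n) ω)]
        gcongr
      simp only [hg]
      gcongr
    obtain ⟨n, hn⟩ := (((hiff u).2 h2).eventually_lt_const one_pos).exists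
    exact absurd hn (not_lt.2 (hu1 n))

end Backward

/-- **Theorem 1.** A quasi-Banach space `X` coarsely embeds into a real, infinite-dimensional
Hilbert space if and only if there is a probability space `(Ω, 𝔅, μ)` such that `X` is
linearly isomorphic to a subspace of `L₀(μ)`. -/
theorem quasiBanach_coarseEmbeds_hilbert_iff_subspace_L0
    (X : Type*) [AddCommGroup X] [Module ℝ X] (q : X → ℝ)
    (hq : IsQuasiNorm q) (hcomplete : QuasiNormComplete q) :
    CoarselyEmbedsIntoHilbert X q ↔ LinIsoSubspaceL0 X q :=
  ⟨hq.linIsoSubspaceL0_of_coarselyEmbeds, hq.coarselyEmbeds_of_linIsoSubspaceL0⟩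
end

section
/- Let X be a quasi-Banach space and suppose there is a probability space (Ω, 𝔅, μ) such that X is linearly isomorphic to a subspace of L₀(μ). Then X coarsely embeds into a (real, infinite-dimensional) Hilbert space. -/
open Filter Function

open MeasureTheory Set
open scoped symmDiff ENNReal

/-- A map that is bounded on bounded distances and uniformly expanding at large distances is a
coarse embedding. -/
theorem IsCoarseEmbedding.of_bounded_of_expanding {X H : Type*} [PseudoMetricSpace H]
    {d : X → X → ℝ} {f : X → H}
    (hbdd : ∀ R, ∃ C, ∀ x y, d x y ≤ R → dist (f x) (f y) ≤ C)
    (hexp : ∀ C, ∃ T, ∀ x y, T ≤ d x y → C ≤ dist (f x) (f y)) :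
    IsCoarseEmbedding d f := by
  let lower : ℝ → Set ℝ := fun t =>
    {r | ∃ x y, t ≤ d x y ∧ r = dist (f x) (f y)} ∪ {r | t ≤ r ∧ 0 ≤ r}
  let upper : ℝ → Set ℝ := fun t => insert 0 {r | ∃ x y, d x y ≤ t ∧ r = dist (f x) (f y)}
  have lower_nonempty (t) : (lower t).Nonempty :=
    ⟨max t 0, Or.inr ⟨le_max_left _ _, le_max_right _ _⟩⟩
  have lower_bdd (t) : BddBelow (lower t) := by
    refine ⟨0, ?_⟩
    rintro r (⟨x, y, -, rfl⟩ | ⟨-, h⟩)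
    exacts [dist_nonneg, h]
  have upper_bdd (t) : BddAbove (upper t) := by
    obtain ⟨C, hC⟩ := hbdd t
    refine ⟨max C 0, ?_⟩
    rintro r (rfl | ⟨x, y, h, rfl⟩)
    exacts [le_max_right _ _, (hC x y h).trans (le_max_left _ _)]
  refine ⟨fun t => sInf (lower t), fun t => sSup (upper t), ?_, ?_, ?_, ?_⟩
  · refine fun s t hst => csInf_le_csInf (lower_bdd s) (lower_nonempty t) ?_
    rintro r (⟨x, y, h, rfl⟩ | ⟨h, h'⟩)
    exacts [Or.inl ⟨x, y, hst.trans h, rfl⟩, Or.inr ⟨hst.trans h, h'⟩]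
  · refine fun s t hst => csSup_le_csSup (upper_bdd t) ⟨0, Or.inl rfl⟩ ?_
    rintro r (rfl | ⟨x, y, h, rfl⟩)
    exacts [Or.inl rfl, Or.inr ⟨x, y, h.trans hst, rfl⟩]
  · refine tendsto_atTop.2 fun C => ?_
    obtain ⟨T, hT⟩ := hexp C
    filter_upwards [eventually_ge_atTop (max T C)] with t ht
    refine le_csInf (lower_nonempty t) ?_
    rintro r (⟨x, y, h, rfl⟩ | ⟨h, -⟩)
    exacts [hT x y (((le_max_left _ _).trans ht).trans h), ((le_max_right _ _).trans ht).trans h]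
  · exact fun x y => ⟨csInf_le (lower_bdd _) (Or.inl ⟨x, y, le_rfl, rfl⟩),
      le_csSup (upper_bdd _) (Or.inr ⟨x, y, le_rfl, rfl⟩)⟩

theorem lp_two_not_finiteDimensional {G : Type*} [NormedAddCommGroup G] [InnerProductSpace ℝ G]
    {g : G} (hg : g ≠ 0) : ¬ FiniteDimensional ℝ (lp (fun _ : ℕ => G) 2) := by
  intro hfin
  have hli : LinearIndependent ℝ
      (fun n : ℕ => (lp.single 2 n g : lp (fun _ : ℕ => G) 2)) := by
    refine linearIndependent_of_ne_zero_of_inner_eq_zero (fun n hn => hg ?_) fun m n hmn => ?_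
    · simpa using congrArg (fun v : lp (fun _ : ℕ => G) 2 => (v : ℕ → G) n) hn
    · change inner ℝ (lp.single 2 m g : lp (fun _ : ℕ => G) 2) (lp.single 2 n g) = 0
      rw [lp.inner_single_left]
      simp [lp.single_apply, hmn]
  exact not_finite_iff_infinite.2 (inferInstanceAs (Infinite ℕ)) hli.finite

/-- Maps into a nontrivial Hilbert space can be glued, in the `ℓ²`-sum, to a coarse embedding as
soon as their squared distances are summable on bounded distances, and each of them eventually
separates points by a fixed amount. -/
theorem coarselyEmbedsIntoHilbert_of_summable {X : Type*} [AddCommGroup X] [Module ℝ X]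
    {q : X → ℝ} {G : Type} [NormedAddCommGroup G] [InnerProductSpace ℝ G] [CompleteSpace G]
    {g : G} (hg : g ≠ 0) (F : ℕ → X → G)
    (hupper : ∀ R, ∃ a : ℕ → ℝ, Summable a ∧
      ∀ n x y, q (x - y) ≤ R → ‖F n x - F n y‖ ^ 2 ≤ a n)
    {δ : ℝ} (hδ : 0 < δ)
    (hlower : ∀ n, ∃ T, ∀ x y, T ≤ q (x - y) → δ ≤ ‖F n x - F n y‖ ^ 2) :
    CoarselyEmbedsIntoHilbert X q := by
  have htwo : (0 : ℝ) < (2 : ℝ≥0∞).toReal := by norm_num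
  have hmem (x : X) : Memℓp (fun n => F n x - F n 0) 2 := by
    obtain ⟨a, ha, h⟩ := hupper (q (x - 0))
    rw [memℓp_gen_iff htwo]
    refine ha.of_nonneg_of_le (fun n => by positivity) fun n => ?_
    simpa using h n x 0 le_rfl
  let f : X → lp (fun _ : ℕ => G) 2 := fun x => ⟨fun n => F n x - F n 0, hmem x⟩
  have hsum (x y : X) : HasSum (fun n => ‖F n x - F n y‖ ^ 2) (dist (f x) (f y) ^ 2) := by
    have h := lp.hasSum_norm htwo (f x - f y)
    rw [← dist_eq_norm] at h
    have hcoord (n : ℕ) : (f x - f y : lp (fun _ : ℕ => G) 2) n = F n x - F n y :=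
      sub_sub_sub_cancel_right _ _ _
    simpa only [hcoord, ENNReal.toReal_ofNat, Real.rpow_ofNat] using h
  refine ⟨⟨lp (fun _ : ℕ => G) 2, lp_two_not_finiteDimensional hg⟩, f,
    IsCoarseEmbedding.of_bounded_of_expanding (fun R => ?_) fun C => ?_⟩
  · obtain ⟨a, ha, h⟩ := hupper R
    refine ⟨√(∑' n, a n), fun x y hxy => Real.le_sqrt_of_sq_le ?_⟩
    exact hasSum_le (fun n => h n x y hxy) (hsum x y) ha.hasSum
  · choose T hT using hlower
    obtain ⟨N, hN⟩ := exists_nat_ge (C ^ 2 / δ)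
    obtain ⟨B, hB⟩ := ((Finset.range N).image T).bddAbove
    refine ⟨B, fun x y hxy => le_of_sq_le_sq ?_ dist_nonneg⟩
    calc C ^ 2 ≤ ∑ n ∈ Finset.range N, δ := by
          rw [div_le_iff₀ hδ] at hN
          simpa using hN
      _ ≤ ∑ n ∈ Finset.range N, ‖F n x - F n y‖ ^ 2 := by
          refine Finset.sum_le_sum fun n hn => hT n x y (le_trans (hB ?_) hxy)
          exact_mod_cast Finset.mem_image_of_mem T hn
      _ ≤ _ := sum_le_hasSum _ (fun n _ => by positivity) (hsum x y)

section UnitStrip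

variable {Ω : Type*} [MeasurableSpace Ω] (μ : Measure Ω)

/-- The strip of height one above the graph of `g`. -/
def unitStrip {Ω : Type*} (g : Ω → ℝ) : Set (Ω × ℝ) :=
  regionBetween g (fun ω => g ω + 1) univ

theorem measurableSet_unitStrip {g : Ω → ℝ} (hg : Measurable g) :
    MeasurableSet (unitStrip g) :=
  measurableSet_regionBetween hg (hg.add_const 1) MeasurableSet.univ

theorem measure_symmDiff_unitStrip {g h : Ω → ℝ} (hg : Measurable g) (hh : Measurable h) :
    (μ.prod volume) (unitStrip g ∆ unitStrip h) =
      ∫⁻ ω, volume (Ioo (g ω) (g ω + 1) ∆ Ioo (h ω) (h ω + 1)) ∂μ := by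
  rw [Measure.prod_apply ((measurableSet_unitStrip hg).symmDiff (measurableSet_unitStrip hh))]
  congr with ω
  congr 1
  ext t
  simp [unitStrip, regionBetween, mem_symmDiff]

variable [IsProbabilityMeasure μ]

theorem measure_unitStrip {g : Ω → ℝ} (hg : Measurable g) :
    (μ.prod volume) (unitStrip g) = 1 := by
  rw [unitStrip, volume_regionBetween_eq_lintegral hg.aemeasurable
    (hg.add_const 1).aemeasurable MeasurableSet.univ]
  simp

/-- The indicator function of the strip of height one above the graph of `g`, in `L²`. -/
noncomputable def unitStripIndicator {g : Ω → ℝ} (hg : Measurable g) :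
    Lp ℝ 2 (μ.prod (volume : Measure ℝ)) :=
  indicatorConstLp 2 (measurableSet_unitStrip hg) (by simp [measure_unitStrip μ hg]) 1

theorem unitStripIndicator_ne_zero {g : Ω → ℝ} (hg : Measurable g) :
    unitStripIndicator μ hg ≠ 0 := by
  rw [← norm_ne_zero_iff, unitStripIndicator, norm_indicatorConstLp (by simp) (by simp)]
  simp [Measure.real, measure_unitStrip μ hg]

theorem norm_unitStripIndicator_sub_sq {g h : Ω → ℝ} (hg : Measurable g) (hh : Measurable h) :
    ‖unitStripIndicator μ hg - unitStripIndicator μ hh‖ ^ 2 =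
      (μ.prod volume).real (unitStrip g ∆ unitStrip h) := by
  rw [← dist_eq_norm, unitStripIndicator, unitStripIndicator, dist_indicatorConstLp_eq_norm,
    norm_indicatorConstLp (by simp) (by simp), ENNReal.toReal_ofNat,
    ← Real.sqrt_eq_rpow, norm_one, one_mul, Real.sq_sqrt measureReal_nonneg]

theorem measure_symmDiff_unitStrip_ne_top {g h : Ω → ℝ} (hg : Measurable g) (hh : Measurable h) :
    (μ.prod volume) (unitStrip g ∆ unitStrip h) ≠ ∞ := by
  refine ne_top_of_le_ne_top ?_ (measure_mono symmDiff_subset_union)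
  exact ne_top_of_le_ne_top (by simp [measure_unitStrip μ hg, measure_unitStrip μ hh])
    (measure_union_le _ _)

theorem volume_symmDiff_Ioo_le_two (a b : ℝ) :
    volume (Ioo a (a + 1) ∆ Ioo b (b + 1)) ≤ 2 := by
  refine (measure_mono symmDiff_subset_union).trans ((measure_union_le _ _).trans ?_)
  simp [one_add_one_eq_two]

theorem volume_symmDiff_Ioo_le (a b : ℝ) :
    volume (Ioo a (a + 1) ∆ Ioo b (b + 1)) ≤ ENNReal.ofReal (2 * |a - b|) := by
  have hsub : Ioo a (a + 1) ∆ Ioo b (b + 1) ⊆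
      Icc (min a b) (max a b) ∪ Icc (min (a + 1) (b + 1)) (max (a + 1) (b + 1)) := by
    intro t ht
    simp only [mem_symmDiff, mem_Ioo, mem_union, mem_Icc, min_le_iff, le_max_iff] at ht ⊢
    grind
  refine (measure_mono hsub).trans ((measure_union_le _ _).trans ?_)
  rw [Real.volume_Icc, Real.volume_Icc, max_sub_min_eq_abs, max_sub_min_eq_abs,
    ← ENNReal.ofReal_add (abs_nonneg _) (abs_nonneg _)]
  refine ENNReal.ofReal_le_ofReal (le_of_eq ?_)
  rw [add_sub_add_right_eq_sub, abs_sub_comm b a]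
  ring

theorem one_le_volume_symmDiff_Ioo {a b : ℝ} (hab : 1 ≤ |a - b|) :
    1 ≤ volume (Ioo a (a + 1) ∆ Ioo b (b + 1)) := by
  have hsub : Ioo a (a + 1) ⊆ Ioo a (a + 1) ∆ Ioo b (b + 1) := by
    intro t ht
    simp only [mem_symmDiff, mem_Ioo] at ht ⊢
    grind
  calc (1 : ℝ≥0∞) = volume (Ioo a (a + 1)) := by simp
    _ ≤ _ := measure_mono hsub

theorem norm_unitStripIndicator_sub_sq_le {g h : Ω → ℝ} (hg : Measurable g) (hh : Measurable h)
    {c : ℝ} (hc : 0 ≤ c) :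
    ‖unitStripIndicator μ hg - unitStripIndicator μ hh‖ ^ 2 ≤
      2 * μ.real {ω | c ≤ |g ω - h ω|} + 2 * c := by
  have hmeas : MeasurableSet {ω | c ≤ |g ω - h ω|} :=
    measurableSet_le measurable_const (by fun_prop)
  rw [norm_unitStripIndicator_sub_sq]
  have hle : (μ.prod volume) (unitStrip g ∆ unitStrip h) ≤
      2 * μ {ω | c ≤ |g ω - h ω|} + ENNReal.ofReal (2 * c) := by
    rw [measure_symmDiff_unitStrip μ hg hh]
    calc _ ≤ ∫⁻ ω, ({ω | c ≤ |g ω - h ω|}.indicator (fun _ => 2) ω + ENNReal.ofReal (2 * c)) ∂μ := by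
          refine lintegral_mono fun ω => ?_
          by_cases hω : c ≤ |g ω - h ω|
          · rw [indicator_of_mem (by exact hω)]
            exact (volume_symmDiff_Ioo_le_two _ _).trans le_self_add
          · rw [indicator_of_notMem (by exact hω), zero_add]
            refine (volume_symmDiff_Ioo_le _ _).trans (ENNReal.ofReal_le_ofReal ?_)
            linarith [not_le.1 hω]
      _ = _ := by
          rw [lintegral_add_right _ measurable_const, lintegral_indicator_const hmeas]
          simp
  refine ENNReal.toReal_le_of_le_ofReal (by positivity) (hle.trans (le_of_eq ?_))
  rw [ENNReal.ofReal_add (by positivity) (by positivity),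
    ENNReal.ofReal_mul (q := μ.real _) zero_le_two, ofReal_measureReal, ENNReal.ofReal_ofNat]

theorem le_norm_unitStripIndicator_sub_sq {g h : Ω → ℝ} (hg : Measurable g) (hh : Measurable h) :
    μ.real {ω | 1 ≤ |g ω - h ω|} ≤ ‖unitStripIndicator μ hg - unitStripIndicator μ hh‖ ^ 2 := by
  have hmeas : MeasurableSet {ω | 1 ≤ |g ω - h ω|} :=
    measurableSet_le measurable_const (by fun_prop)
  rw [norm_unitStripIndicator_sub_sq]
  refine ENNReal.toReal_mono (measure_symmDiff_unitStrip_ne_top μ hg hh) ?_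
  rw [measure_symmDiff_unitStrip μ hg hh, ← lintegral_indicator_one hmeas]
  refine lintegral_mono fun ω => ?_
  by_cases hω : 1 ≤ |g ω - h ω|
  · rw [indicator_of_mem (by exact hω)]
    exact one_le_volume_symmDiff_Ioo hω
  · rw [indicator_of_notMem (by exact hω)]
    exact zero_le

end UnitStrip

section Embedding

variable {X : Type*} [AddCommGroup X] [Module ℝ X] {q : X → ℝ}
  {Ω : Type*} [MeasurableSpace Ω] {μ : Measure Ω} [IsProbabilityMeasure μ] {U : X →ₗ[ℝ] (Ω → ℝ)}

/-- A continuous linear map into `L₀` sends the unit ball to a set bounded in measure. -/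
theorem IsQuasiNorm.exists_forall_measure_le (hq : IsQuasiNorm q)
    (hcont : ∀ u : ℕ → X, Tendsto (fun n => q (u n)) atTop (nhds 0) →
      TendstoInMeasure μ (fun n => U (u n)) atTop (0 : Ω → ℝ))
    {ε : ℝ} (hε : 0 < ε) :
    ∃ M > 0, ∀ x, q x ≤ 1 → μ.real {ω | M ≤ |U x ω|} ≤ ε := by
  by_contra! hcon
  choose u hu hμu using fun n : ℕ => hcon (n + 1) (by positivity)
  have hlim : Tendsto (fun n : ℕ => q ((1 / ((n : ℝ) + 1)) • u n)) atTop (nhds 0) := by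
    refine squeeze_zero (fun n => hq.nonneg _) (fun n => ?_) tendsto_one_div_add_atTop_nhds_zero_nat
    rw [hq.smul, abs_of_pos (by positivity)]
    exact mul_le_of_le_one_right (by positivity) (hu n)
  have hmeas := tendstoInMeasure_iff_measureReal_norm.1 (hcont _ hlim) 1 one_pos
  obtain ⟨n, hn⟩ := (hmeas.eventually_lt_const hε).exists
  refine (hμu n).not_ge (le_trans (le_of_eq ?_) hn.le)
  congr 1 with ω
  have hpos : (0 : ℝ) < n + 1 := by positivity
  simp [abs_of_pos hpos, inv_mul_eq_div, le_div_iff₀ hpos]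

/-- A linear map into `L₀` with continuous inverse is uniformly bounded away from `0` in measure
on the unit sphere. -/
theorem IsQuasiNorm.exists_le_measure
    (hinv : ∀ u : ℕ → X, TendstoInMeasure μ (fun n => U (u n)) atTop (0 : Ω → ℝ) →
      Tendsto (fun n => q (u n)) atTop (nhds 0)) :
    ∃ δ > 0, ∀ x, q x = 1 → δ ≤ μ.real {ω | δ ≤ |U x ω|} := by
  by_contra! hcon
  choose u hu hμu using fun n : ℕ => hcon (1 / ((n : ℝ) + 1)) (by positivity)
  have hmeas : TendstoInMeasure μ (fun n => U (u n)) atTop (0 : Ω → ℝ) := by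
    refine tendstoInMeasure_iff_measureReal_norm.2 fun ε hε => ?_
    have hinv_lim := tendsto_one_div_add_atTop_nhds_zero_nat (𝕜 := ℝ)
    refine squeeze_zero' (Eventually.of_forall fun n => measureReal_nonneg) ?_ hinv_lim
    filter_upwards [hinv_lim.eventually_le_const hε] with n hn
    refine le_trans (measureReal_mono fun ω hω => ?_) (hμu n).le
    exact hn.trans (by simpa using hω)
  have hlim := hinv u hmeas
  simp only [hu] at hlim
  exact one_ne_zero (tendsto_nhds_unique tendsto_const_nhds hlim)

end Embedding

/-- If a quasi-Banach space `X` is linearly isomorphic to a subspace of `L₀(μ)` for some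
probability space `(Ω, 𝔅, μ)`, then `X` coarsely embeds into a real, infinite-dimensional
Hilbert space. -/
theorem quasiBanach_subspace_L0_coarseEmbeds_hilbert
    (X : Type*) [AddCommGroup X] [Module ℝ X] (q : X → ℝ)
    (hq : IsQuasiNorm q) (hcomplete : QuasiNormComplete q)
    (hL0 : LinIsoSubspaceL0 X q) :
    CoarselyEmbedsIntoHilbert X q := by
  obtain ⟨Ω, _, μ, _, U, hU, -, hiff⟩ := hL0
  choose M hM hμM using fun n : ℕ =>
    hq.exists_forall_measure_le (fun u => (hiff u).1) (ε := (1 / 2) ^ n) (by positivity)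
  obtain ⟨δ, hδ, hμδ⟩ := IsQuasiNorm.exists_le_measure fun u => (hiff u).2
  let s : ℕ → ℝ := fun n => 2 ^ n * M n
  have hs (n) : 0 < s n := mul_pos (by positivity) (hM n)
  have hsU (n x) : Measurable fun ω => U x ω / s n := (hU x).div_const _
  have hsub (n x y) (ω : Ω) : |U x ω / s n - U y ω / s n| = |U (x - y) ω| / s n := by
    rw [← sub_div, abs_div, abs_of_pos (hs n), map_sub, Pi.sub_apply]
  have hscale {r : ℝ} (hr : 0 < r) (x : X) (ω : Ω) : |U (r⁻¹ • x) ω| = |U x ω| / r := by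
    rw [map_smul, Pi.smul_apply, smul_eq_mul, abs_mul, abs_of_pos (inv_pos.2 hr), inv_mul_eq_div]
  refine coarselyEmbedsIntoHilbert_of_summable (unitStripIndicator_ne_zero μ (hsU 0 0))
    (fun n x => unitStripIndicator μ (hsU n x)) (fun R => ?_) hδ fun n => ?_
  · let r := max R 1
    have hr : 0 < r := lt_max_of_lt_right one_pos
    refine ⟨fun n => (2 + 2 * r) * (1 / 2) ^ n, summable_geometric_two.mul_left _,
      fun n x y hxy => ?_⟩
    have hball : q (r⁻¹ • (x - y)) ≤ 1 := by
      rw [hq.smul, abs_of_pos (inv_pos.2 hr), inv_mul_le_one₀ hr]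
      exact hxy.trans (le_max_left _ _)
    have hset : {ω | r * (1 / 2) ^ n ≤ |U x ω / s n - U y ω / s n|} =
        {ω | M n ≤ |U (r⁻¹ • (x - y)) ω|} := by
      ext ω
      rw [mem_ofPred_eq, mem_ofPred_eq, hsub, hscale hr, le_div_iff₀ (hs n), le_div_iff₀ hr]
      have hcancel : r * (1 / 2) ^ n * s n = M n * r := by
        simp only [s, one_div, inv_pow]
        field_simp
      rw [hcancel]
    have hle := norm_unitStripIndicator_sub_sq_le μ (hsU n x) (hsU n y)
      (c := r * (1 / 2) ^ n) (by positivity)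
    rw [hset] at hle
    linarith [hμM n _ hball]
  · refine ⟨s n / δ, fun x y hxy => ?_⟩
    have hpos : 0 < q (x - y) := (div_pos (hs n) hδ).trans_le hxy
    have hsphere : q ((q (x - y))⁻¹ • (x - y)) = 1 := by
      rw [hq.smul, abs_of_pos (inv_pos.2 hpos), inv_mul_cancel₀ hpos.ne']
    refine (hμδ _ hsphere).trans (le_trans (measureReal_mono fun ω hω => ?_)
      (le_norm_unitStripIndicator_sub_sq μ (hsU n x) (hsU n y)))
    rw [mem_ofPred_eq, hscale hpos, le_div_iff₀ hpos] at hω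
    rw [mem_ofPred_eq, hsub, one_le_div (hs n)]
    rw [div_le_iff₀ hδ] at hxy
    linarith
end
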